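/- arXiv:1701.08955 — 6 statements merged into one kernel-verified Lean document; each statement's English description precedes it below -/
import Mathlib

section
/- For every continuous compactly supported function φ : ℝ → ℂ, the limit as ε → 0⁺ of (1/(2πi)) ∫_ℝ ( φ(x)/(x − iε) − φ(x)/(x + iε) ) dx exists and equals φ(0). (This expresses that the Dirac delta at 0 is the boundary value of (1/(2πi))·(1/z).) -/
open MeasureTheory Filter Complex

lemma tendsto_norm_mul_inv_one_add_sq_cobounded :
    Tendsto (fun x : ℝ => ‖x‖ * (Real.pi⁻¹ * (1 + x ^ 2)⁻¹)) (Bornology.cobounded ℝ) (nhds 0) := by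
  have h : Tendsto (fun x : ℝ => Real.pi⁻¹ * ‖x‖⁻¹) (Bornology.cobounded ℝ) (nhds 0) := by
    simpa using (tendsto_inv_atTop_zero.comp
      (tendsto_norm_cobounded_atTop (E := ℝ))).const_mul Real.pi⁻¹
  refine squeeze_zero' (Eventually.of_forall fun x => by positivity) ?_ h
  filter_upwards [(tendsto_norm_cobounded_atTop (E := ℝ)).eventually_gt_atTop 0] with x hx
  have hle : ‖x‖ * (1 + x ^ 2)⁻¹ ≤ ‖x‖⁻¹ := by
    rw [← div_eq_mul_inv, inv_eq_one_div, div_le_div_iff₀ (by positivity) hx, ← sq,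
      Real.norm_eq_abs, sq_abs]
    linarith
  calc ‖x‖ * (Real.pi⁻¹ * (1 + x ^ 2)⁻¹) = Real.pi⁻¹ * (‖x‖ * (1 + x ^ 2)⁻¹) := by ring
    _ ≤ Real.pi⁻¹ * ‖x‖⁻¹ := by gcongr

lemma cauchy_kernel_difference (w : ℂ) (x : ℝ) {ε : ℝ} (hε : 0 < ε) :
    (ε⁻¹ * (Real.pi⁻¹ * (1 + (ε⁻¹ * x) ^ 2)⁻¹)) • w =
      (1 / (2 * Real.pi * Complex.I)) *
        (w / ((x : ℂ) - Complex.I * (ε : ℂ)) - w / ((x : ℂ) + Complex.I * (ε : ℂ))) := by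
  have hsub : (x : ℂ) - Complex.I * (ε : ℂ) ≠ 0 := fun h => by
    simpa [hε.ne'] using congrArg Complex.im h
  have hadd : (x : ℂ) + Complex.I * (ε : ℂ) ≠ 0 := fun h => by
    simpa [hε.ne'] using congrArg Complex.im h
  have hε' : (ε : ℂ) ≠ 0 := by exact_mod_cast hε.ne'
  have hπ : (Real.pi : ℂ) ≠ 0 := by exact_mod_cast Real.pi_ne_zero
  have hprod : ((x : ℂ) - Complex.I * ε) * (x + Complex.I * ε) = ε ^ 2 + x ^ 2 := by
    linear_combination (-(ε : ℂ) ^ 2) * Complex.I_sq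
  have hsum : (ε : ℂ) ^ 2 + x ^ 2 ≠ 0 := hprod ▸ mul_ne_zero hsub hadd
  have hkernel : (ε : ℂ)⁻¹ * (1 + ((ε : ℂ)⁻¹ * x) ^ 2)⁻¹ = ε / (ε ^ 2 + x ^ 2) := by
    rw [show 1 + ((ε : ℂ)⁻¹ * x) ^ 2 = (ε ^ 2 + x ^ 2) / ε ^ 2 by field_simp]
    field_simp
  rw [div_sub_div _ _ hsub hadd, hprod, Complex.real_smul]
  push_cast
  rw [mul_left_comm, hkernel]
  field_simp
  ring

/-- The Dirac delta at `0` is the boundary value of `(1/(2πi))·(1/z)`: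
for every continuous compactly supported `φ : ℝ → ℂ`, the limit as `ε → 0⁺` of
`(1/(2πi)) ∫ (φ(x)/(x − iε) − φ(x)/(x + iε)) dx` exists and equals `φ 0`. -/
theorem dirac_as_boundary_value (φ : ℝ → ℂ) (hφ : Continuous φ)
    (hsupp : HasCompactSupport φ) :
    Tendsto
      (fun ε : ℝ =>
        (1 / (2 * Real.pi * Complex.I)) *
          ∫ x : ℝ, (φ x / ((x : ℂ) - Complex.I * (ε : ℂ)) -
            φ x / ((x : ℂ) + Complex.I * (ε : ℂ))))
      (nhdsWithin 0 (Set.Ioi 0)) (nhds (φ 0)) := by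
  have hkernel : ∫ x : ℝ, Real.pi⁻¹ * (1 + x ^ 2)⁻¹ = 1 := by
    rw [integral_const_mul, integral_univ_inv_one_add_sq, inv_mul_cancel₀ Real.pi_ne_zero]
  have hpeak := (tendsto_integral_comp_smul_smul_of_integrable (μ := volume)
    (φ := fun x : ℝ => Real.pi⁻¹ * (1 + x ^ 2)⁻¹) (fun x => by positivity) hkernel
    (by simpa only [Module.finrank_self, pow_one] using
      tendsto_norm_mul_inv_one_add_sq_cobounded)
    (hφ.integrable_of_hasCompactSupport hsupp) hφ.continuousAt).comp
      tendsto_inv_nhdsGT_zero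
  refine hpeak.congr' ?_
  filter_upwards [self_mem_nhdsWithin] with ε hε
  simp only [Function.comp_apply, Module.finrank_self, pow_one, smul_eq_mul]
  rw [← integral_const_mul]
  exact integral_congr_ae (Eventually.of_forall fun x => cauchy_kernel_difference (φ x) x hε)
end

section
/- Let u : ℝ → ℂ be continuous and compactly supported and let f be its Cauchy transform. Then for every t ∈ ℝ, the limit as ε → 0⁺ of ( f(t + iε) − f(t − iε) ) exists and equals u(t). (In other words, u is recovered as the boundary-value jump across ℝ of the holomorphic function f, so u is the boundary value of a holomorphic function on ℂ ∖ ℝ.) -/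
open MeasureTheory Filter Complex

open Bornology Real in
theorem tendsto_integral_poissonKernel_smul {E : Type*} [NormedAddCommGroup E] [NormedSpace ℝ E]
    [CompleteSpace E] {u : ℝ → E} {t : ℝ} (hu : Integrable u) (hut : ContinuousAt u t) :
    Tendsto (fun ε : ℝ => ∫ x : ℝ, (ε / (π * ((t - x) ^ 2 + ε ^ 2))) • u x)
      (nhdsWithin 0 (Set.Ioi 0)) (nhds (u t)) := by
  have decay : Tendsto (fun x : ℝ => ‖x‖ ^ Module.finrank ℝ ℝ * (π⁻¹ * (1 + x ^ 2)⁻¹))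
      (cobounded ℝ) (nhds 0) := by
    have hinv : Tendsto (fun x : ℝ => π⁻¹ * ‖x‖⁻¹) (cobounded ℝ) (nhds 0) := by
      simpa using (tendsto_inv_atTop_zero.comp (tendsto_norm_cobounded_atTop (E := ℝ))).const_mul
        π⁻¹
    refine squeeze_zero (fun x => by positivity) (fun x => ?_) hinv
    rw [Module.finrank_self, pow_one, mul_left_comm]
    gcongr
    rcases eq_or_ne x 0 with rfl | hx
    · simp
    · have hx' : 0 < ‖x‖ := norm_pos_iff.2 hx
      rw [← div_eq_mul_inv, div_le_iff₀ (by positivity), ← sq_abs x, ← Real.norm_eq_abs,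
        mul_add, sq, inv_mul_cancel_left₀ hx'.ne']
      exact le_add_of_nonneg_left (by positivity)
  have key := (tendsto_integral_comp_smul_smul_of_integrable' (μ := volume)
    (φ := fun x : ℝ => π⁻¹ * (1 + x ^ 2)⁻¹) (fun x => by positivity)
    (by rw [integral_const_mul, integral_univ_inv_one_add_sq, inv_mul_cancel₀ pi_ne_zero])
    decay hu hut).comp tendsto_inv_nhdsGT_zero
  refine key.congr' ?_
  filter_upwards [self_mem_nhdsWithin] with ε (hε : 0 < ε)
  refine integral_congr_ae (Eventually.of_forall fun x => ?_)
  dsimp only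
  congr 1
  rw [Module.finrank_self, pow_one, smul_eq_mul]
  field_simp
  ring

theorem ofReal_sub_ne_zero_of_im_ne_zero {z : ℂ} (hz : z.im ≠ 0) (x : ℝ) : (x : ℂ) - z ≠ 0 :=
  fun h => hz (by simpa using congrArg Complex.im h)

theorem integrable_div_ofReal_sub {u : ℝ → ℂ} (hu : Continuous u) (hsupp : HasCompactSupport u)
    {z : ℂ} (hz : z.im ≠ 0) : Integrable fun x : ℝ => u x / ((x : ℂ) - z) := by
  have hcont : Continuous fun x : ℝ => u x / ((x : ℂ) - z) :=
    hu.div (by fun_prop) (ofReal_sub_ne_zero_of_im_ne_zero hz)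
  refine hcont.integrable_of_hasCompactSupport ?_
  simp only [div_eq_mul_inv]
  exact hsupp.mul_right

/-- Let `u : ℝ → ℂ` be continuous and compactly supported and let `f` be its Cauchy
transform `f z = (1/(2πi)) ∫ u(x)/(x − z) dx`. Then for every real `t`, the limit as
`ε → 0⁺` of `f(t + iε) − f(t − iε)` exists and equals `u t`: the function `u` is
recovered as the boundary-value jump of `f` across `ℝ`. -/
theorem cauchyTransform_boundary_jump (u : ℝ → ℂ) (hu : Continuous u)
    (hsupp : HasCompactSupport u) (f : ℂ → ℂ)
    (hf : ∀ z : ℂ, f z = (1 / (2 * Real.pi * Complex.I)) *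
      ∫ x : ℝ, u x / ((x : ℂ) - z)) (t : ℝ) :
    Tendsto (fun ε : ℝ => f ((t : ℂ) + Complex.I * (ε : ℂ)) -
        f ((t : ℂ) - Complex.I * (ε : ℂ)))
      (nhdsWithin 0 (Set.Ioi 0)) (nhds (u t)) := by
  refine (tendsto_integral_poissonKernel_smul (hu.integrable_of_hasCompactSupport hsupp)
    hu.continuousAt).congr' ?_
  filter_upwards [self_mem_nhdsWithin] with ε (hε : 0 < ε)
  have h_upper : ((t : ℂ) + Complex.I * (ε : ℂ)).im ≠ 0 := by simpa using hε.ne'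
  have h_lower : ((t : ℂ) - Complex.I * (ε : ℂ)).im ≠ 0 := by simpa using hε.ne'
  rw [hf, hf, ← mul_sub, ← integral_sub (integrable_div_ofReal_sub hu hsupp h_upper)
    (integrable_div_ofReal_sub hu hsupp h_lower), ← integral_const_mul]
  refine integral_congr_ae (Eventually.of_forall fun x => ?_)
  have hx_upper := ofReal_sub_ne_zero_of_im_ne_zero h_upper x
  have hx_lower := ofReal_sub_ne_zero_of_im_ne_zero h_lower x
  have h_factor : ((t : ℂ) - x) ^ 2 + (ε : ℂ) ^ 2 =
      ((x : ℂ) - (t + Complex.I * ε)) * ((x : ℂ) - (t - Complex.I * ε)) := by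
    linear_combination (ε : ℂ) ^ 2 * Complex.I_sq
  have hπ : (Real.pi : ℂ) ≠ 0 := Complex.ofReal_ne_zero.2 Real.pi_ne_zero
  dsimp only
  rw [Complex.real_smul]
  push_cast
  rw [h_factor, div_sub_div _ _ hx_upper hx_lower]
  field_simp
  ring
end

section
/- Let n ≥ 2 and regard ℝⁿ ⊆ ℂⁿ as the set M = { z ∈ ℂⁿ : Im(z_j) = 0 for all j }. Then every function f : ℂⁿ → ℂ that is holomorphic on ℂⁿ ∖ M extends to an entire function: there exists F : ℂⁿ → ℂ holomorphic on all of ℂⁿ with F = f on ℂⁿ ∖ M. (Equivalently, the quotient space O(ℂⁿ ∖ ℝⁿ)/O(ℂⁿ) vanishes as soon as n > 1.) -/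
open Metric Set Filter Topology in
/-- A holomorphic function on an open subset of a finite-dimensional complex space is `C¹`. -/
theorem DifferentiableOn.continuousOn_fderiv_complex {E : Type*} [NormedAddCommGroup E]
    [NormedSpace ℂ E] [FiniteDimensional ℂ E] {f : E → ℂ} {W : Set E}
    (hf : DifferentiableOn ℂ f W) (hW : IsOpen W) : ContinuousOn (fderiv ℂ f) W := by
  rw [continuousOn_clm_apply]
  intro e x₀ hx₀
  obtain ⟨δ, hδ, hball⟩ := Metric.isOpen_iff.1 hW x₀ hx₀
  obtain ⟨ρ, hρ, hρe⟩ : ∃ ρ : ℝ, 0 < ρ ∧ ρ * ‖e‖ < δ / 2 := by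
    refine ⟨δ / 2 / (‖e‖ + 1), by positivity, ?_⟩
    rw [div_mul_eq_mul_div, div_lt_iff₀ (by positivity)]
    nlinarith [norm_nonneg e]
  have hmem : ∀ x ∈ ball x₀ (δ / 2), ∀ t : ℂ, ‖t‖ ≤ ρ → x + t • e ∈ W := by
    intro x hx t ht
    apply hball
    rw [mem_ball, dist_eq_norm] at hx ⊢
    calc ‖x + t • e - x₀‖ = ‖(x - x₀) + t • e‖ := by congr 1; abel
      _ ≤ ‖x - x₀‖ + ‖t‖ * ‖e‖ := by
        simpa [norm_smul] using norm_add_le (x - x₀) (t • e)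
      _ < δ / 2 + δ / 2 := by
        have := mul_le_mul_of_nonneg_right ht (norm_nonneg e)
        linarith
      _ = δ := by ring
  have hcauchy : ∀ x ∈ ball x₀ (δ / 2), fderiv ℂ f x e =
      (2 * Real.pi * Complex.I : ℂ)⁻¹ •
        ∮ t in C(0, ρ), (1 / (t - 0) ^ 2) • f (x + t • e) := by
    intro x hx
    have hx0 : x ∈ W := by simpa using hmem x hx 0 (by simpa using hρ.le)
    have hd : DifferentiableOn ℂ (fun t : ℂ ↦ f (x + t • e)) (closedBall 0 ρ) := by
      refine hf.comp (by fun_prop) fun t ht ↦ hmem x hx t (by simpa using ht)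
    rw [hd.deriv_eq_smul_circleIntegral hρ, inv_smul_smul₀ Complex.two_pi_I_ne_zero]
    have h1 : HasDerivAt (fun t : ℂ ↦ x + t • e) e 0 := by
      simpa using ((hasDerivAt_id (0 : ℂ)).smul_const e).const_add x
    have h2 : HasFDerivAt f (fderiv ℂ f x) (x + (0 : ℂ) • e) := by
      simpa using (hf.differentiableAt (hW.mem_nhds hx0)).hasFDerivAt
    exact (h2.comp_hasDerivAt (0 : ℂ) h1).deriv.symm
  have hcont : ContinuousOn (fun x ↦ ∮ t in C(0, ρ), (1 / (t - 0) ^ 2) • f (x + t • e))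
      (ball x₀ (δ / 2)) := by
    rw [continuousOn_iff_continuous_domRestrict]
    refine intervalIntegral.continuous_parametric_intervalIntegral_of_continuous' ?_ _ _
    have hne : ∀ θ : ℝ, circleMap 0 ρ θ ^ 2 ≠ 0 := fun θ ↦
      pow_ne_zero _ (circleMap_ne_center hρ.ne')
    have hfc : Continuous fun p : ball x₀ (δ / 2) × ℝ ↦ f (p.1 + circleMap 0 ρ p.2 • e) :=
      hf.continuousOn.comp_continuous (by fun_prop) fun p ↦
        hmem p.1 p.1.2 _ (by simp [abs_of_pos hρ])
    have hinv : Continuous fun p : ball x₀ (δ / 2) × ℝ ↦ 1 / circleMap 0 ρ p.2 ^ 2 :=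
      continuous_const.div (by fun_prop) fun p ↦ hne p.2
    have hderiv : Continuous fun p : ball x₀ (δ / 2) × ℝ ↦ circleMap 0 ρ p.2 * Complex.I := by
      fun_prop
    simp only [deriv_circleMap, sub_zero]
    exact hderiv.smul (hinv.smul hfc)
  have hnhds := ball_mem_nhds x₀ (half_pos hδ)
  refine ContinuousAt.continuousWithinAt ?_
  refine ((hcont.continuousAt hnhds).const_smul (2 * Real.pi * Complex.I : ℂ)⁻¹).congr ?_
  filter_upwards [hnhds] with x hx using (hcauchy x hx).symm

open Metric Set Filter Topology in
/-- A circle integral depending holomorphically on a parameter is a holomorphic function of the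
parameter. -/
theorem differentiableAt_circleIntegral_param {E : Type*} [NormedAddCommGroup E]
    [NormedSpace ℂ E] [FiniteDimensional ℂ E] {H : E × ℂ → ℂ} {W : Set (E × ℂ)}
    (hH : DifferentiableOn ℂ H W) (hW : IsOpen W) {x₀ : E} {c : ℂ} {R : ℝ}
    (hx₀ : ∀ ζ ∈ sphere c |R|, (x₀, ζ) ∈ W) :
    DifferentiableAt ℂ (fun x ↦ ∮ ζ in C(c, R), H (x, ζ)) x₀ := by
  have : ProperSpace E := FiniteDimensional.proper ℂ E
  have hK : IsCompact (sphere c |R|) := isCompact_sphere _ _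
  obtain ⟨u, v, hu, -, hxu, hv, huv⟩ := generalized_tube_lemma (isCompact_singleton (x := x₀)) hK
    hW (by rintro ⟨x, ζ⟩ ⟨rfl, hζ⟩; exact hx₀ ζ hζ)
  obtain ⟨ε, hε, hεu⟩ := nhds_basis_closedBall.mem_iff.1 (hu.mem_nhds (hxu rfl))
  have hmem : ∀ x ∈ closedBall x₀ ε, ∀ θ : ℝ, (x, circleMap c R θ) ∈ W := fun x hx θ ↦
    huv ⟨hεu hx, hv (circleMap_mem_sphere' c R θ)⟩
  have hH' := hH.continuousOn_fderiv_complex hW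
  obtain ⟨B, hB⟩ := ((isCompact_closedBall x₀ ε).prod hK).exists_bound_of_continuousOn
    (hH'.mono fun p hp ↦ huv ⟨hεu hp.1, hv hp.2⟩)
  have hs : closedBall x₀ ε ∈ 𝓝 x₀ := closedBall_mem_nhds x₀ hε
  have hderiv : Continuous fun θ : ℝ ↦ circleMap 0 R θ * Complex.I := by fun_prop
  have hcont : ∀ x ∈ closedBall x₀ ε,
      Continuous fun θ : ℝ ↦ deriv (circleMap c R) θ • H (x, circleMap c R θ) := by
    intro x hx
    simp only [deriv_circleMap]
    exact hderiv.smul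
      (hH.continuousOn.comp_continuous (by fun_prop) (hmem x hx))
  let F' : E → ℝ → E →L[ℂ] ℂ := fun x θ ↦ deriv (circleMap c R) θ •
    (fderiv ℂ H (x, circleMap c R θ)).comp (ContinuousLinearMap.inl ℂ E ℂ)
  refine (intervalIntegral.hasFDerivAt_integral_of_dominated_of_fderiv_le (F' := F')
    (bound := fun _ ↦ |R| * (B * ‖ContinuousLinearMap.inl ℂ E ℂ‖)) hs ?_ ?_ ?_ ?_ ?_
    ?_).differentiableAt
  · filter_upwards [hs] with x hx using (hcont x hx).aestronglyMeasurable
  · exact (hcont x₀ (mem_of_mem_nhds hs)).intervalIntegrable _ _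
  · refine Continuous.aestronglyMeasurable ?_
    simp only [F', deriv_circleMap]
    exact hderiv.smul ((hH'.comp_continuous (by fun_prop)
      (hmem x₀ (mem_of_mem_nhds hs))).clm_comp continuous_const)
  · refine Eventually.of_forall fun θ _ x hx ↦ ?_
    simp only [F', norm_smul, deriv_circleMap, norm_mul, Complex.norm_I, mul_one,
      norm_circleMap_zero]
    gcongr
    refine (ContinuousLinearMap.opNorm_comp_le _ _).trans ?_
    gcongr
    exact hB _ ⟨hx, circleMap_mem_sphere' c R θ⟩
  · exact intervalIntegrable_const
  · refine Eventually.of_forall fun θ _ x hx ↦ ?_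
    have h1 := (hH.differentiableAt (hW.mem_nhds (hmem x hx θ))).hasFDerivAt
    have h2 : HasFDerivAt (fun e : E ↦ (e, circleMap c R θ)) (ContinuousLinearMap.inl ℂ E ℂ) x :=
      hasFDerivAt_prodMk_left x _
    exact (HasFDerivAt.comp (g := H) x h1 h2).const_smul (deriv (circleMap c R) θ)

open Metric Set Filter Topology in
/-- Identity theorem: a holomorphic function on a preconnected open set that vanishes near a point
of the set vanishes on the whole set. -/
theorem DifferentiableOn.eqOn_zero_of_isPreconnected {E : Type*} [NormedAddCommGroup E]
    [NormedSpace ℂ E] {g : E → ℂ} {U : Set E} (hg : DifferentiableOn ℂ g U) (hU : IsOpen U)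
    (hc : IsPreconnected U) {x₀ : E} (hx₀ : x₀ ∈ U) (h0 : g =ᶠ[𝓝 x₀] 0) : EqOn g 0 U := by
  suffices h : U ⊆ {x | g =ᶠ[𝓝 x] 0} from fun x hx ↦ (h hx).self_of_nhds
  refine hc.subset_of_closure_inter_subset ?_ ⟨x₀, hx₀, h0⟩ ?_
  · exact isOpen_setOfPred_eventually_nhds
  rintro p ⟨hp, hpU⟩
  obtain ⟨r, hr, hball⟩ := Metric.isOpen_iff.1 hU p hpU
  obtain ⟨q, hq, hpq⟩ := Metric.mem_closure_iff.1 hp r hr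
  have hqb : q ∈ ball p r := by rwa [mem_ball, dist_comm]
  change ∀ᶠ x in 𝓝 p, g x = 0
  filter_upwards [ball_mem_nhds p hr] with x hx
  set ℓ : ℂ → E := fun t ↦ q + t • (x - q)
  have hℓ : Continuous ℓ := by fun_prop
  have hconv : IsPreconnected (ℓ ⁻¹' ball p r) := by
    refine Convex.isPreconnected ?_
    intro s hs t ht a b ha hb hab
    let : NormedSpace ℝ E := NormedSpace.restrictScalars ℝ ℂ E
    have hcv := convex_ball p r hs ht ha hb hab
    have e : ℓ (a • s + b • t) = a • ℓ s + b • ℓ t := by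
      have h1 : ∀ (a : ℝ) (y : E), a • y = (a : ℂ) • y := fun _ _ ↦ rfl
      have h2 : (b : ℂ) = 1 - a := by rw [← Complex.ofReal_one, ← hab]; push_cast; ring
      simp only [ℓ, h1, Complex.real_smul, h2]
      module
    rw [mem_preimage, e]
    exact hcv
  have han : AnalyticOnNhd ℂ (g ∘ ℓ) (ℓ ⁻¹' ball p r) :=
    ((hg.mono hball).comp (f := ℓ) (by fun_prop) fun t ht ↦ ht).analyticOnNhd
      (isOpen_ball.preimage hℓ)
  have h0' : g ∘ ℓ =ᶠ[𝓝 0] 0 := by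
    have : Tendsto ℓ (𝓝 0) (𝓝 q) := hℓ.tendsto' 0 q (by simp [ℓ])
    exact this.eventually hq
  have := han.eqOn_zero_of_preconnected_of_eventuallyEq_zero hconv
    (z₀ := 0) (by simpa [ℓ] using hqb) h0' (x := 1) (by simpa [ℓ] using hx)
  simpa [ℓ] using this

/-- The complement of `ℝⁿ` in `ℂⁿ` is connected for `n ≥ 2`. -/
theorem isPreconnected_compl_forall_im_eq_zero {n : ℕ} (hn : 2 ≤ n) :
    IsPreconnected ({z : Fin n → ℂ | ∀ j, (z j).im = 0}ᶜ) := by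
  let L : (Fin n → ℂ) →ₗ[ℝ] (Fin n → ℝ) := Complex.imLm.compLeft (Fin n)
  have hL : Function.Surjective L := fun y ↦
    ⟨fun j ↦ y j * Complex.I, by ext j; simp [L]⟩
  have hker : (L.ker : Set (Fin n → ℂ)) = {z | ∀ j, (z j).im = 0} := by
    ext z; simp [L, funext_iff]
  rw [← hker]
  refine (isConnected_compl_of_one_lt_codim ?_).isPreconnected
  rw [(L.quotKerEquivOfSurjective hL).rank_eq, rank_fin_fun]
  exact_mod_cast hn

/-- The point over `ζ` (in the `i`-th coordinate) of the complex parabola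
`z j + I * (z i) ^ 2 = const` through `z`. -/
noncomputable def parabola {n : ℕ} (i j : Fin n) (z : Fin n → ℂ) (ζ : ℂ) : Fin n → ℂ :=
  z + Pi.single i (ζ - z i) + Pi.single j (Complex.I * (z i ^ 2 - ζ ^ 2))

/-- If it is negative, the parabola through `z` avoids `ℝⁿ`; otherwise it is the squared modulus
of the parameters at which the parabola may meet `ℝⁿ`. -/
def parabolaLevel {n : ℕ} (i j : Fin n) (z : Fin n → ℂ) : ℝ := (z j).im + (z i ^ 2).re

theorem parabola_self {n : ℕ} (i j : Fin n) (z : Fin n → ℂ) : parabola i j z (z i) = z := by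
  simp [parabola]

theorem differentiable_parabola {n : ℕ} (i j : Fin n) :
    Differentiable ℂ fun p : (Fin n → ℂ) × ℂ ↦ parabola i j p.1 p.2 := by
  rw [differentiable_pi]
  intro k
  simp only [parabola, Pi.add_apply, Pi.single_apply]
  split_ifs <;> fun_prop

theorem continuous_parabolaLevel {n : ℕ} (i j : Fin n) : Continuous (parabolaLevel i j) := by
  unfold parabolaLevel
  fun_prop

theorem norm_sq_eq_parabolaLevel {n : ℕ} {i j : Fin n} (hij : i ≠ j) {z : Fin n → ℂ} {ζ : ℂ}
    (h : ∀ k, (parabola i j z ζ k).im = 0) : ‖ζ‖ ^ 2 = parabolaLevel i j z := by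
  have hi := h i
  have hj := h j
  simp [parabola, hij, hij.symm] at hi hj
  rw [← Complex.normSq_eq_norm_sq, Complex.normSq_apply]
  simp [parabolaLevel, pow_two] at hj ⊢
  rw [hi] at hj ⊢
  linarith

/-- The Cauchy integral of `f` along the parabola through `z`, over the circle of radius `R`. -/
noncomputable def parabolaIntegral {n : ℕ} (i j : Fin n) (f : (Fin n → ℂ) → ℂ) (R : ℝ)
    (z : Fin n → ℂ) : ℂ :=
  (2 * Real.pi * Complex.I : ℂ)⁻¹ • ∮ ζ in C(0, R), (ζ - z i)⁻¹ • f (parabola i j z ζ)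

section

variable {n : ℕ} {i j : Fin n} {f : (Fin n → ℂ) → ℂ} {z : Fin n → ℂ} {R R' : ℝ}

theorem isOpen_compl_forall_im_eq_zero : IsOpen ({z : Fin n → ℂ | ∀ j, (z j).im = 0}ᶜ) := by
  have : {z : Fin n → ℂ | ∀ j, (z j).im = 0} = ⋂ j, {z | (z j).im = 0} := by ext; simp
  rw [this, isOpen_compl_iff]
  exact isClosed_iInter fun j ↦ isClosed_eq (by fun_prop) continuous_const

theorem parabola_mem_compl (hij : i ≠ j) {ζ : ℂ} (h : parabolaLevel i j z < ‖ζ‖ ^ 2) :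
    parabola i j z ζ ∈ ({z : Fin n → ℂ | ∀ j, (z j).im = 0}ᶜ) := fun hm ↦
  h.ne' (norm_sq_eq_parabolaLevel hij hm)

theorem differentiableAt_comp_parabola (hij : i ≠ j)
    (hf : DifferentiableOn ℂ f {z : Fin n → ℂ | ∀ j, (z j).im = 0}ᶜ) {ζ : ℂ}
    (h : parabolaLevel i j z < ‖ζ‖ ^ 2) :
    DifferentiableAt ℂ (fun ζ ↦ f (parabola i j z ζ)) ζ := by
  have h1 := hf.differentiableAt
    (isOpen_compl_forall_im_eq_zero.mem_nhds (parabola_mem_compl hij h))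
  have h2 : DifferentiableAt ℂ (parabola i j z) ζ :=
    ((differentiable_parabola i j).comp (f := fun ζ : ℂ ↦ (z, ζ)) (by fun_prop)) ζ
  exact h1.comp ζ h2

theorem differentiableAt_parabolaIntegral (hij : i ≠ j)
    (hf : DifferentiableOn ℂ f {z : Fin n → ℂ | ∀ j, (z j).im = 0}ᶜ)
    (hzR : ‖z i‖ < R) (hlev : parabolaLevel i j z < R ^ 2) :
    DifferentiableAt ℂ (parabolaIntegral i j f R) z := by
  have hR : 0 < R := (norm_nonneg _).trans_lt hzR
  let W : Set ((Fin n → ℂ) × ℂ) := {p | p.2 - p.1 i ≠ 0} ∩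
    (fun p : (Fin n → ℂ) × ℂ ↦ parabola i j p.1 p.2) ⁻¹' {z | ∀ j, (z j).im = 0}ᶜ
  have hW : IsOpen W := (isOpen_ne_fun (by fun_prop) continuous_const).inter
    (isOpen_compl_forall_im_eq_zero.preimage (differentiable_parabola i j).continuous)
  have hH : DifferentiableOn ℂ (fun p : (Fin n → ℂ) × ℂ ↦
      (p.2 - p.1 i)⁻¹ • f (parabola i j p.1 p.2)) W := by
    have hsub : DifferentiableOn ℂ (fun p : (Fin n → ℂ) × ℂ ↦ p.2 - p.1 i) W := by fun_prop
    refine (hsub.inv fun p hp ↦ hp.1).smul ?_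
    exact hf.comp (differentiable_parabola i j).differentiableOn fun p hp ↦ hp.2
  refine DifferentiableAt.const_smul (c := (2 * Real.pi * Complex.I : ℂ)⁻¹)
    (differentiableAt_circleIntegral_param (c := 0) (R := R) hH hW fun ζ hζ ↦ ?_)
  have hζ' : ‖ζ‖ = R := by simpa [abs_of_pos hR] using hζ
  refine ⟨fun h ↦ ?_, parabola_mem_compl hij (by rwa [hζ'])⟩
  rw [show ζ = z i from sub_eq_zero.1 h] at hζ'
  exact hzR.ne hζ'

theorem parabolaIntegral_eq_of_le (hij : i ≠ j)
    (hf : DifferentiableOn ℂ f {z : Fin n → ℂ | ∀ j, (z j).im = 0}ᶜ)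
    (hzR : ‖z i‖ < R) (hlev : parabolaLevel i j z < R ^ 2) (hRR' : R ≤ R') :
    parabolaIntegral i j f R' z = parabolaIntegral i j f R z := by
  have hR : 0 < R := (norm_nonneg _).trans_lt hzR
  have hd : ∀ ζ : ℂ, R ≤ ‖ζ‖ →
      DifferentiableAt ℂ (fun ζ ↦ (ζ - z i)⁻¹ • f (parabola i j z ζ)) ζ := by
    intro ζ hζ
    have hsub : DifferentiableAt ℂ (fun ζ ↦ ζ - z i) ζ := by fun_prop
    refine (hsub.inv fun h ↦ ?_).smul
      (differentiableAt_comp_parabola hij hf (hlev.trans_le (by gcongr)))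
    rw [sub_eq_zero.1 h] at hζ
    exact hζ.not_gt hzR
  unfold parabolaIntegral
  congr 1
  refine Complex.circleIntegral_eq_of_differentiable_on_annulus_off_countable hR hRR'
    Set.countable_empty (fun ζ hζ ↦ (hd ζ ?_).continuousAt.continuousWithinAt) fun ζ hζ ↦ hd ζ ?_
  · simpa using hζ.2
  · have := hζ.1.2
    simp only [Metric.mem_closedBall, dist_zero_right, not_le] at this
    exact this.le

theorem parabolaIntegral_eq_self (hij : i ≠ j)
    (hf : DifferentiableOn ℂ f {z : Fin n → ℂ | ∀ j, (z j).im = 0}ᶜ)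
    (hzR : ‖z i‖ < R) (hlev : parabolaLevel i j z < 0) :
    parabolaIntegral i j f R z = f z := by
  have hd : Differentiable ℂ fun ζ ↦ f (parabola i j z ζ) := fun ζ ↦
    differentiableAt_comp_parabola hij hf (hlev.trans_le (by positivity))
  have := hd.diffContOnCl.two_pi_i_inv_smul_circleIntegral_sub_inv_smul
    (show z i ∈ Metric.ball 0 R by simpa using hzR)
  rwa [parabola_self] at this

end


/-- Hartogs-type vanishing: for `n ≥ 2`, regarding `ℝⁿ ⊆ ℂⁿ` as
`M = {z : Fin n → ℂ | ∀ j, (z j).im = 0}`, every function holomorphic on `ℂⁿ ∖ M`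
extends to an entire function on `ℂⁿ`. Equivalently, `O(ℂⁿ ∖ ℝⁿ)/O(ℂⁿ) = 0` for `n > 1`. -/
theorem holomorphic_extends_across_Rn (n : ℕ) (hn : 2 ≤ n)
    (f : (Fin n → ℂ) → ℂ)
    (hf : DifferentiableOn ℂ f {z : Fin n → ℂ | ∀ j, (z j).im = 0}ᶜ) :
    ∃ F : (Fin n → ℂ) → ℂ, Differentiable ℂ F ∧
      ∀ z ∈ ({z : Fin n → ℂ | ∀ j, (z j).im = 0}ᶜ : Set (Fin n → ℂ)), F z = f z := by
  have hij : (⟨0, by lia⟩ : Fin n) ≠ ⟨1, by lia⟩ := by simp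
  set i : Fin n := ⟨0, by lia⟩
  set j : Fin n := ⟨1, by lia⟩
  let ρ : (Fin n → ℂ) → ℝ := fun z ↦ ‖z i‖ + |parabolaLevel i j z| + 1
  have hρ : ∀ z, ‖z i‖ < ρ z ∧ parabolaLevel i j z < ρ z ^ 2 := fun z ↦ by
    have h1 := norm_nonneg (z i)
    have h2 := abs_nonneg (parabolaLevel i j z)
    have h3 := le_abs_self (parabolaLevel i j z)
    constructor
    · simp only [ρ]; linarith
    · simp only [ρ]; nlinarith
  let F : (Fin n → ℂ) → ℂ := fun z ↦ parabolaIntegral i j f (ρ z) z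
  have hF : Differentiable ℂ F := by
    intro z
    refine (differentiableAt_parabolaIntegral hij hf (hρ z).1 (hρ z).2).congr_of_eventuallyEq ?_
    have h1 : ∀ᶠ w : Fin n → ℂ in nhds z, ‖w i‖ < ρ z :=
      (continuous_apply i).norm.continuousAt.eventually_lt continuousAt_const (hρ z).1
    have h2 : ∀ᶠ w in nhds z, parabolaLevel i j w < ρ z ^ 2 :=
      (continuous_parabolaLevel i j).continuousAt.eventually_lt continuousAt_const (hρ z).2
    filter_upwards [h1, h2] with w hw1 hw2
    rcases le_total (ρ z) (ρ w) with h | h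
    · exact parabolaIntegral_eq_of_le hij hf hw1 hw2 h
    · exact (parabolaIntegral_eq_of_le hij hf (hρ w).1 (hρ w).2 h).symm
  refine ⟨F, hF, fun z hz ↦ sub_eq_zero.1 ?_⟩
  let z₀ : Fin n → ℂ := Pi.single j (-Complex.I)
  have hz₀ : parabolaLevel i j z₀ < 0 := by simp [parabolaLevel, z₀, hij]
  refine (hF.differentiableOn.sub hf).eqOn_zero_of_isPreconnected isOpen_compl_forall_im_eq_zero
    (isPreconnected_compl_forall_im_eq_zero hn) (x₀ := z₀) (fun h ↦ ?_) ?_ hz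
  · simpa [z₀] using h j
  · filter_upwards [(continuous_parabolaLevel i j).continuousAt.eventually_lt continuousAt_const
      hz₀] with w hw
    exact sub_eq_zero.2 (parabolaIntegral_eq_self hij hf (hρ w).1 hw)
end

section
/- Let n ≥ 1, let U ⊆ ℂⁿ be an open neighborhood of 0, and let f : U → ℂ be holomorphic with f(0) = 0 and f not identically zero on any neighborhood of 0. Let p be the power series expansion of f at 0, for each k let f_k(x) = p_k(x, …, x) be the degree-k homogeneous component, and let m be the smallest k such that f_k is not identically zero; set g = f_m. Then the Whitney normal cone at the origin of the zero set S = { x ∈ U : f(x) = 0 } equals the zero set of g: C₀(S) = { x ∈ ℂⁿ : g(x) = 0 }. -/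
open Filter

open scoped Topology

section LeadingForm

variable {E : Type*} [NormedAddCommGroup E] [NormedSpace ℂ E]

/-- A continuous multilinear form evaluated on the diagonal is homogeneous. -/
lemma ContinuousMultilinearMap.map_diag_smul {m : ℕ}
    (q : ContinuousMultilinearMap ℂ (fun _ : Fin m => E) ℂ) (c : ℂ) (x : E) :
    q (fun _ => c • x) = c ^ m * q (fun _ => x) := by
  simpa using q.map_smul_univ (fun _ => c) (fun _ => x)

lemma ContinuousMultilinearMap.continuous_diag {m : ℕ}
    (q : ContinuousMultilinearMap ℂ (fun _ : Fin m => E) ℂ) :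
    Continuous (fun x : E => q (fun _ => x)) :=
  q.cont.comp (continuous_pi fun _ => continuous_id)

/-- A function differs from the lowest nonvanishing homogeneous component of its power series by
a term of higher order. -/
lemma HasFPowerSeriesAt.isBigO_sub_leading {f : E → ℂ} {p : FormalMultilinearSeries ℂ E ℂ}
    (hp : HasFPowerSeriesAt f p 0) {m : ℕ} (hmin : ∀ k < m, ∀ x : E, p k (fun _ => x) = 0) :
    (fun y => f y - p m (fun _ => y)) =O[𝓝 0] fun y => ‖y‖ ^ (m + 1) := by
  refine (hp.isBigO_sub_partialSum_pow (m + 1)).congr_left fun y => ?_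
  have hsum : p.partialSum (m + 1) y = p m (fun _ => y) := by
    rw [FormalMultilinearSeries.partialSum, Finset.sum_range_succ,
      Finset.sum_eq_zero fun k hk => hmin k (Finset.mem_range.1 hk) y, zero_add]
  rw [zero_add, hsum]

/-- If `q` does not vanish at `w`, then it does not vanish on small circles around `v` in the
complex direction `w`. -/
lemma ContinuousMultilinearMap.eventually_diag_line_ne_zero {m : ℕ}
    (q : ContinuousMultilinearMap ℂ (fun _ : Fin m => E) ℂ) (v : E) {w : E}
    (hw : q (fun _ => w) ≠ 0) : ∀ᶠ s : ℂ in 𝓝[≠] 0, q (fun _ => v + s • w) ≠ 0 := by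
  have hd : Differentiable ℂ (fun s : ℂ => q (fun _ => v + s • w)) := by
    have h : Differentiable ℂ (fun s : ℂ => (fun _ : Fin m => v + s • w)) := by fun_prop
    exact fun s => (q.hasFDerivAt _).differentiableAt.comp s (h s)
  have han : AnalyticOnNhd ℂ (fun s : ℂ => q (fun _ => v + s • w)) Set.univ :=
    fun s _ => hd.analyticAt s
  refine (han 0 trivial).eventually_eq_zero_or_eventually_ne_zero.resolve_left fun h0 => hw ?_
  have hz : ∀ s : ℂ, q (fun _ => v + s • w) = 0 := fun s =>
    han.eqOn_zero_of_preconnected_of_eventuallyEq_zero isPreconnected_univ trivial h0 trivial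
  have hu : ∀ u : ℂ, u ≠ 0 → q (fun _ => u • v + w) = 0 := fun u hu => by
    have hvec : u • v + w = u • (v + u⁻¹ • w) := by
      rw [smul_add, smul_smul, mul_inv_cancel₀ hu, one_smul]
    rw [hvec, q.map_diag_smul, hz, mul_zero]
  have hcont : Continuous fun u : ℂ => q (fun _ => u • v + w) :=
    q.continuous_diag.comp (by fun_prop)
  have hlim : Tendsto (fun u : ℂ => q (fun _ => u • v + w)) (𝓝[≠] 0) (𝓝 (q (fun _ => w))) := by
    simpa using (hcont.tendsto 0).mono_left nhdsWithin_le_nhds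
  refine tendsto_nhds_unique hlim (tendsto_const_nhds.congr' ?_)
  filter_upwards [self_mem_nhdsWithin] with u h using (hu u h).symm

/-- Minimum modulus principle: a holomorphic function on a disc that is smaller at the centre than
on the bounding circle has a zero in the closed disc. -/
lemma exists_zero_of_norm_lt_on_sphere {h : ℂ → ℂ} {ε C : ℝ} (hε : 0 < ε)
    (hd : ∀ s ∈ Metric.closedBall (0 : ℂ) ε, DifferentiableAt ℂ h s)
    (hC : 0 < C) (hs : ∀ s ∈ Metric.sphere (0 : ℂ) ε, C ≤ ‖h s‖) (h0 : ‖h 0‖ < C) :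
    ∃ s ∈ Metric.closedBall (0 : ℂ) ε, h s = 0 := by
  by_contra! hne
  have hcl : closure (Metric.ball (0 : ℂ) ε) = Metric.closedBall 0 ε := closure_ball 0 hε.ne'
  have hdc : DiffContOnCl ℂ (fun s => (h s)⁻¹) (Metric.ball 0 ε) := by
    refine DifferentiableOn.diffContOnCl fun s hs => ?_
    rw [hcl] at hs
    exact ((hd s hs).inv (hne s hs)).differentiableWithinAt
  have hle := Complex.norm_le_of_forall_mem_frontier_norm_le (C := C⁻¹) (z := 0)
    Metric.isBounded_ball hdc (fun s hsf => by
      rw [frontier_ball 0 hε.ne'] at hsf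
      rw [norm_inv]
      exact inv_anti₀ hC (hs s hsf)) (subset_closure (Metric.mem_ball_self hε))
  rw [norm_inv] at hle
  have hpos : 0 < ‖h 0‖ := norm_pos_iff.2 (hne 0 (Metric.mem_closedBall_self hε.le))
  exact absurd ((inv_le_inv₀ hpos hC).1 hle) (not_le.2 h0)

/-- Near a direction `v` on which the leading form `q` of `f` vanishes, `f` has zeros arbitrarily
close to the origin. -/
lemma exists_zero_near_of_leading_eq_zero {U : Set E} (hU : IsOpen U) (hU0 : (0 : E) ∈ U)
    {f : E → ℂ} (hf : DifferentiableOn ℂ f U) {m : ℕ}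
    (q : ContinuousMultilinearMap ℂ (fun _ : Fin m => E) ℂ)
    (hO : (fun y => f y - q (fun _ => y)) =O[𝓝 0] fun y => ‖y‖ ^ (m + 1))
    {v w : E} (hv : q (fun _ => v) = 0) (hw : q (fun _ => w) ≠ 0) {η : ℝ} (hη : 0 < η) :
    ∃ (t : ℝ) (s : ℂ), 0 < t ∧ t ≤ η ∧ ‖s‖ ≤ η ∧
      (t : ℂ) • (v + s • w) ∈ U ∧ f ((t : ℂ) • (v + s • w)) = 0 := by
  obtain ⟨C, hC, hbound⟩ := hO.exists_pos
  obtain ⟨r, hr, hball⟩ := Metric.eventually_nhds_iff_ball.1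
    (hbound.bound.and (hU.mem_nhds hU0))
  obtain ⟨ε₀, hε₀, hne⟩ := Metric.eventually_nhds_iff_ball.1
    (eventually_nhdsWithin_iff.1 (q.eventually_diag_line_ne_zero v hw))
  obtain ⟨ε, hε, hε'⟩ : ∃ ε : ℝ, 0 < ε ∧ ε < min ε₀ (min η 1) :=
    exists_between (by positivity)
  simp only [lt_min_iff] at hε'
  obtain ⟨hεε₀, hεη, hε1⟩ := hε'
  have hcont : Continuous fun s : ℂ => ‖q (fun _ => v + s • w)‖ :=
    (q.continuous_diag.comp (by fun_prop)).norm
  obtain ⟨s₀, hs₀, hmin⟩ := (isCompact_sphere (0 : ℂ) ε).exists_isMinOn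
    (NormedSpace.sphere_nonempty.2 hε.le) hcont.continuousOn
  set δ := ‖q (fun _ => v + s₀ • w)‖ with hδ
  have hδ0 : 0 < δ := by
    rw [mem_sphere_zero_iff_norm] at hs₀
    refine norm_pos_iff.2 (hne s₀ (by simpa [hs₀] using hεε₀) ?_)
    rintro rfl
    simp at hs₀
    exact hε.ne hs₀
  set M := ‖v‖ + ‖w‖ + 1 with hM
  have hM0 : 0 < M := by positivity
  obtain ⟨t, ht, ht'⟩ : ∃ t : ℝ, 0 < t ∧ t < min η (min (r / M) (δ / (2 * (C * M ^ (m + 1))))) :=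
    exists_between (by positivity)
  simp only [lt_min_iff] at ht'
  obtain ⟨htη, htr, htδ⟩ := ht'
  rw [lt_div_iff₀ hM0] at htr
  rw [lt_div_iff₀ (by positivity)] at htδ
  have hnorm : ∀ s ∈ Metric.closedBall (0 : ℂ) ε, ‖(t : ℂ) • (v + s • w)‖ ≤ t * M := by
    intro s hs
    rw [mem_closedBall_zero_iff] at hs
    rw [norm_smul, Complex.norm_real, Real.norm_of_nonneg ht.le]
    gcongr
    calc ‖v + s • w‖ ≤ ‖v‖ + ‖s‖ * ‖w‖ := (norm_add_le _ _).trans (by rw [norm_smul])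
      _ ≤ ‖v‖ + 1 * ‖w‖ := by gcongr; linarith
      _ ≤ M := by rw [hM]; linarith
  have hmem : ∀ s ∈ Metric.closedBall (0 : ℂ) ε, (t : ℂ) • (v + s • w) ∈ Metric.ball (0 : E) r :=
    fun s hs => mem_ball_zero_iff.2 ((hnorm s hs).trans_lt htr)
  have herr : ∀ s ∈ Metric.closedBall (0 : ℂ) ε,
      ‖f ((t : ℂ) • (v + s • w)) - (t : ℂ) ^ m * q (fun _ => v + s • w)‖ <
        t ^ m * (δ / 2) := by
    intro s hs
    have h := (hball _ (hmem s hs)).1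
    rw [q.map_diag_smul, norm_pow, norm_norm] at h
    calc _ ≤ C * ‖(t : ℂ) • (v + s • w)‖ ^ (m + 1) := h
      _ ≤ C * (t * M) ^ (m + 1) := by gcongr; exact hnorm s hs
      _ = t ^ m * (t * (C * M ^ (m + 1))) := by rw [mul_pow, pow_succ t, mul_left_comm C, mul_assoc]
      _ < t ^ m * (δ / 2) := by gcongr; linarith
  obtain ⟨s, hs, hfs⟩ := exists_zero_of_norm_lt_on_sphere (C := t ^ m * (δ / 2))
    (h := fun s : ℂ => f ((t : ℂ) • (v + s • w))) hε
    (fun s hs => by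
      have hfd : DifferentiableAt ℂ f ((t : ℂ) • (v + s • w)) :=
        hf.differentiableAt (hU.mem_nhds (hball _ (hmem s hs)).2)
      exact hfd.comp s (f := fun s : ℂ => (t : ℂ) • (v + s • w)) (by fun_prop))
    (by positivity)
    (fun s hs => by
      have h := herr s (Metric.sphere_subset_closedBall hs)
      have hq : δ ≤ ‖q (fun _ => v + s • w)‖ := hmin hs
      have hge : t ^ m * δ ≤ ‖(t : ℂ) ^ m * q (fun _ => v + s • w)‖ := by
        rw [norm_mul, norm_pow, Complex.norm_real, Real.norm_of_nonneg ht.le]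
        gcongr
      have htri := norm_sub_norm_le ((t : ℂ) ^ m * q (fun _ => v + s • w))
        (f ((t : ℂ) • (v + s • w)))
      rw [norm_sub_rev] at htri
      linarith)
    (by simpa [hv] using herr 0 (Metric.mem_closedBall_self hε.le))
  exact ⟨t, s, ht, htη.le, (mem_closedBall_zero_iff.1 hs).trans hεη.le,
    (hball _ (hmem s hs)).2, hfs⟩

/-- The leading form of `f` vanishes on limits of rescaled zeros of `f`. -/
lemma leading_eq_zero_of_tendsto {f : E → ℂ} {m : ℕ}
    (q : ContinuousMultilinearMap ℂ (fun _ : Fin m => E) ℂ)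
    (hO : (fun y => f y - q (fun _ => y)) =O[𝓝 0] fun y => ‖y‖ ^ (m + 1))
    {x : ℕ → E} {c : ℕ → ℂ} {v : E} (hx : ∀ k, f (x k) = 0) (hx0 : Tendsto x atTop (𝓝 0))
    (hv : Tendsto (fun k => c k • x k) atTop (𝓝 v)) : q (fun _ => v) = 0 := by
  obtain ⟨C, hC⟩ := hO.bound
  refine tendsto_nhds_unique ((q.continuous_diag.tendsto v).comp hv) ?_
  have hlim : Tendsto (fun k => C * (‖c k • x k‖ ^ m * ‖x k‖)) atTop (𝓝 0) := by
    simpa using ((hv.norm.pow m).mul hx0.norm).const_mul C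
  refine squeeze_zero_norm' ?_ hlim
  filter_upwards [hx0.eventually hC] with k hk
  rw [hx, zero_sub, norm_neg, norm_pow, norm_norm] at hk
  rw [Function.comp_apply, q.map_diag_smul, norm_mul, norm_pow, norm_smul]
  calc ‖c k‖ ^ m * ‖q (fun _ => x k)‖ ≤ ‖c k‖ ^ m * (C * ‖x k‖ ^ (m + 1)) := by gcongr
    _ = C * ((‖c k‖ * ‖x k‖) ^ m * ‖x k‖) := by rw [mul_pow, pow_succ]; ring

end LeadingForm

/-- Let `U ⊆ ℂⁿ` (`n ≥ 1`) be an open neighborhood of `0` and `f : U → ℂ` holomorphic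
with `f 0 = 0` and `f` not identically zero on any neighborhood of `0`. Let `p` be the
power series expansion of `f` at `0`, let `f_k x = p_k(x, …, x)` be the degree-`k`
homogeneous components, and let `m` be the smallest `k` with `f_k` not identically
zero; set `g = f_m`. Then the Whitney normal cone at the origin of the zero set
`S = {x ∈ U | f x = 0}` equals the zero set of `g`. -/
theorem whitney_cone_of_zero_set (n : ℕ) (hn : 1 ≤ n)
    (U : Set (Fin n → ℂ)) (hU : IsOpen U) (hU0 : (0 : Fin n → ℂ) ∈ U)
    (f : (Fin n → ℂ) → ℂ) (hf : DifferentiableOn ℂ f U) (hf0 : f 0 = 0)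
    (hfnz : ∀ W ∈ nhds (0 : Fin n → ℂ), ∃ x ∈ W, f x ≠ 0)
    (p : FormalMultilinearSeries ℂ (Fin n → ℂ) ℂ) (hp : HasFPowerSeriesAt f p 0)
    (m : ℕ) (hm : ∃ x : Fin n → ℂ, p m (fun _ => x) ≠ 0)
    (hmin : ∀ k < m, ∀ x : Fin n → ℂ, p k (fun _ => x) = 0) :
    {v : Fin n → ℂ | ∃ (x : ℕ → (Fin n → ℂ)) (c : ℕ → ℝ),
        (∀ k, x k ∈ {y ∈ U | f y = 0}) ∧ (∀ k, 0 < c k) ∧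
        Tendsto x atTop (nhds 0) ∧ Tendsto (fun k => c k • x k) atTop (nhds v)}
      = {x : Fin n → ℂ | p m (fun _ => x) = 0} := by
  have hO := hp.isBigO_sub_leading hmin
  ext v
  constructor
  · rintro ⟨x, c, hx, -, hx0, hv⟩
    exact leading_eq_zero_of_tendsto (c := fun k => (c k : ℂ)) (p m) hO (fun k => (hx k).2) hx0
      (by simpa only [Complex.coe_smul] using hv)
  · intro hv
    obtain ⟨w, hw⟩ := hm
    choose t s ht htη hsη hmem hzero using fun k : ℕ =>
      exists_zero_near_of_leading_eq_zero hU hU0 hf (p m) hO hv hw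
        (Nat.one_div_pos_of_nat (α := ℝ) (n := k))
    have ht0 : Tendsto t atTop (𝓝 0) :=
      squeeze_zero (fun k => (ht k).le) htη tendsto_one_div_add_atTop_nhds_zero_nat
    have hs0 : Tendsto s atTop (𝓝 0) :=
      squeeze_zero_norm hsη tendsto_one_div_add_atTop_nhds_zero_nat
    have hlim : Tendsto (fun k => v + s k • w) atTop (𝓝 v) := by
      simpa using (hs0.smul_const w).const_add v
    refine ⟨fun k => (t k : ℂ) • (v + s k • w), fun k => (t k)⁻¹, fun k => ⟨hmem k, hzero k⟩,
      fun k => inv_pos.2 (ht k), ?_, hlim.congr fun k => ?_⟩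
    · simpa using ((Complex.continuous_ofReal.tendsto 0).comp ht0).smul hlim
    · simp only [Complex.coe_smul, inv_smul_smul₀ (ht k).ne']
end

section
/- Let M ⊆ ℝ be open and let X, X' ⊆ ℂ be open sets with X' ⊆ X and X ∩ ℝ = X' ∩ ℝ = M. Then the map induced by restriction of holomorphic functions is a linear isomorphism O(X ∖ M)/O(X) ≅ O(X' ∖ M)/O(X'); that is, the space of hyperfunctions B(M) = O(X ∖ M)/O(X) depends only on M and not on the choice of the complex neighborhood X. -/
noncomputable section

/-- The space `O(S)` of holomorphic functions on `S`, as a submodule of `ℂ → ℂ`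
(a function represents its restriction to `S`). -/
def hol (S : Set ℂ) : Submodule ℂ (ℂ → ℂ) where
  carrier := {f | DifferentiableOn ℂ f S}
  add_mem' := fun hf hg => hf.add hg
  zero_mem' := differentiableOn_const 0
  smul_mem' := fun c _ hf => hf.const_smul c

/-- The submodule of `O(S)` of those functions which coincide on `S` with a function
holomorphic on `X` (for `S ⊆ X`, this is the image of the restriction map
`O(X) → O(S)`, together with the identification of functions agreeing on `S`). -/
def holFrom (X S : Set ℂ) : Submodule ℂ ↥(hol S) where
  carrier := {f | ∃ g : ℂ → ℂ, DifferentiableOn ℂ g X ∧ Set.EqOn (f : ℂ → ℂ) g S}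
  add_mem' := by
    rintro f₁ f₂ ⟨g₁, hg₁, he₁⟩ ⟨g₂, hg₂, he₂⟩
    exact ⟨g₁ + g₂, hg₁.add hg₂, fun z hz => by
      simp [he₁ hz, he₂ hz]⟩
  zero_mem' := ⟨0, differentiableOn_const 0, fun z _ => rfl⟩
  smul_mem' := by
    rintro c f ⟨g, hg, he⟩
    exact ⟨c • g, hg.const_smul c, fun z hz => by simp [he hz]⟩

/-- The space of hyperfunctions `B = O(X ∖ M)/O(X)` associated with the complex
neighborhood `X`; here `M` is regarded as a subset of `ℂ`. -/
def Hyperfun (X M : Set ℂ) : Type :=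
  ↥(hol (X \ M)) ⧸ holFrom X (X \ M)

instance (X M : Set ℂ) : AddCommGroup (Hyperfun X M) :=
  inferInstanceAs (AddCommGroup (↥(hol (X \ M)) ⧸ holFrom X (X \ M)))

instance (X M : Set ℂ) : Module ℂ (Hyperfun X M) :=
  inferInstanceAs (Module ℂ (↥(hol (X \ M)) ⧸ holFrom X (X \ M)))

section

open Complex MeasureTheory Set Filter Topology
open scoped ContDiff Manifold

/-- `HasDbarAt u c z` means that `u` is real differentiable at `z` and that its Wirtinger
derivative `∂u/∂z̄ = (∂u/∂x + i ∂u/∂y) / 2` at `z` equals `c`. -/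
def HasDbarAt (u : ℂ → ℂ) (c z : ℂ) : Prop :=
  ∃ L : ℂ →L[ℝ] ℂ, HasFDerivAt u L z ∧ L 1 + I * L I = 2 * c

namespace HasDbarAt

variable {u v : ℂ → ℂ} {c d z : ℂ}

theorem zero_iff : HasDbarAt u 0 z ↔ DifferentiableAt ℂ u z := by
  rw [differentiableAt_complex_iff_differentiableAt_real]
  constructor
  · rintro ⟨L, hL, h⟩
    refine ⟨hL.differentiableAt, ?_⟩
    rw [hL.fderiv, smul_eq_mul]
    linear_combination (-I) * h + L I * I_sq
  · rintro ⟨hu, h⟩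
    refine ⟨_, hu.hasFDerivAt, ?_⟩
    rw [smul_eq_mul] at h
    linear_combination I * h + fderiv ℝ u z 1 * I_sq

theorem congr_of_eventuallyEq (h : HasDbarAt u c z) (he : v =ᶠ[𝓝 z] u) : HasDbarAt v c z := by
  obtain ⟨L, hL, h⟩ := h
  exact ⟨L, hL.congr_of_eventuallyEq he, h⟩

theorem add (hu : HasDbarAt u c z) (hv : HasDbarAt v d z) :
    HasDbarAt (fun w => u w + v w) (c + d) z := by
  obtain ⟨L, hL, h⟩ := hu
  obtain ⟨L', hL', h'⟩ := hv
  refine ⟨L + L', hL.add hL', ?_⟩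
  simp only [add_apply]
  linear_combination h + h'

theorem mul (hu : HasDbarAt u c z) (hv : HasDbarAt v d z) :
    HasDbarAt (fun w => u w * v w) (u z * d + c * v z) z := by
  obtain ⟨L, hL, h⟩ := hu
  obtain ⟨L', hL', h'⟩ := hv
  refine ⟨_, hL.mul hL', ?_⟩
  simp only [add_apply, smul_apply, smul_eq_mul]
  linear_combination (u z) * h' + v z * h

theorem const_mul (a : ℂ) (hu : HasDbarAt u c z) : HasDbarAt (fun w => a * u w) (a * c) z := by
  simpa using (zero_iff.2 (differentiableAt_const a)).mul hu

theorem sub (hu : HasDbarAt u c z) (hv : HasDbarAt v d z) :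
    HasDbarAt (fun w => u w - v w) (c - d) z := by
  simpa [sub_eq_add_neg] using hu.add (hv.const_mul (-1))

theorem sum {ι : Type*} {s : Finset ι} {f : ι → ℂ → ℂ} {a : ι → ℂ}
    (h : ∀ i ∈ s, HasDbarAt (f i) (a i) z) :
    HasDbarAt (fun w => ∑ i ∈ s, f i w) (∑ i ∈ s, a i) z := by
  classical
  induction s using Finset.induction_on with
  | empty => simpa using zero_iff.2 (differentiableAt_const 0)
  | insert i s hi ih =>
    simp only [Finset.sum_insert hi]
    exact (h i (Finset.mem_insert_self i s)).add
      (ih fun j hj => h j (Finset.mem_insert_of_mem hj))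

end HasDbarAt

/-- The Cauchy transform `(1/π) ∫ φ(z - ζ) / ζ dA(ζ)`. -/
def cauchyTransform (φ : ℂ → ℂ) (z : ℂ) : ℂ :=
  (Real.pi : ℂ)⁻¹ * ∫ ζ, ζ⁻¹ * φ (z - ζ)

theorem locallyIntegrable_inv_complex : LocallyIntegrable (fun z : ℂ => z⁻¹) := by
  refine locallyIntegrable_of_norm_le_rpow (C := 1) (α := 1) ?_ ?_ ?_ ?_
  · simp
  · simp
  · filter_upwards with z
    rw [norm_inv, Real.rpow_neg_one, one_mul]
  · exact measurable_inv.aestronglyMeasurable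

theorem integral_inv_mul_wirtinger {φ : ℂ → ℂ} (hφ : ContDiff ℝ 1 φ) (hc : HasCompactSupport φ)
    (z : ℂ) :
    ∫ ζ : ℂ, ζ⁻¹ * (fderiv ℝ φ (z - ζ) 1 + I * fderiv ℝ φ (z - ζ) I) = 2 * Real.pi * φ z := by
  let e : ℝ → ℂ := fun θ => Real.cos θ + Real.sin θ * I
  have he : Continuous e := by fun_prop
  have hen : ∀ θ, ‖e θ‖ = 1 := fun θ => by
    simp only [e, ofReal_cos, ofReal_sin, ← exp_mul_I, norm_exp_ofReal_mul_I]
  have hed : ∀ θ, HasDerivAt e (I * e θ) θ := fun θ => by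
    have h := ((Real.hasDerivAt_cos θ).ofReal_comp).add
      (((Real.hasDerivAt_sin θ).ofReal_comp).mul_const I)
    refine h.congr_deriv ?_
    simp only [e]
    push_cast
    linear_combination (-Complex.sin θ) * I_sq
  let A : ℝ × ℝ → ℂ := fun p => fderiv ℝ φ (z - p.1 * e p.2) (e p.2)
  let B : ℝ × ℝ → ℂ := fun p => I * fderiv ℝ φ (z - p.1 * e p.2) (I * e p.2)
  have hDc : Continuous (fderiv ℝ φ) := hφ.continuous_fderiv one_ne_zero
  have hA : Continuous A := by
    refine Continuous.clm_apply (hDc.comp ?_) ?_ <;> fun_prop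
  have hB : Continuous B := by
    refine continuous_const.mul (Continuous.clm_apply (hDc.comp ?_) ?_) <;> fun_prop
  obtain ⟨R, hR⟩ := hc.isBounded.subset_closedBall z
  have hout : ∀ r θ : ℝ, R < |r| → z - r * e θ ∉ tsupport φ := by
    intro r θ hr hm
    have h := hR hm
    rw [mem_closedBall_iff_norm, sub_sub_cancel_left, norm_neg, norm_mul, hen, mul_one,
      norm_real, Real.norm_eq_abs] at h
    exact absurd h (not_le.2 hr)
  have hD0 : ∀ r θ : ℝ, R < |r| → fderiv ℝ φ (z - r * e θ) = 0 := fun r θ hr =>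
    image_eq_zero_of_notMem_tsupport fun h => hout r θ hr (tsupport_fderiv_subset ℝ h)
  have hint : ∀ F : ℝ × ℝ → ℂ, Continuous F → (∀ p : ℝ × ℝ, R < |p.1| → F p = 0) →
      IntegrableOn F (Ioi 0 ×ˢ Ioo (-Real.pi) Real.pi) (volume.prod volume) := by
    intro F hF h0
    have hK : IsCompact (Icc 0 R ×ˢ Icc (-Real.pi) Real.pi) := isCompact_Icc.prod isCompact_Icc
    refine IntegrableOn.of_forall_sdiff_eq_zero (hF.continuousOn.integrableOn_compact hK)
      (measurableSet_Ioi.prod measurableSet_Ioo) ?_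
    rintro ⟨r, θ⟩ ⟨⟨hr, hθ⟩, hn⟩
    refine h0 _ ?_
    by_contra hle
    exact hn ⟨⟨le_of_lt hr, (le_abs_self r).trans (not_lt.1 hle)⟩, Ioo_subset_Icc_self hθ⟩
  have hAi := hint A hA fun p hp => by simp [A, hD0 _ _ hp]
  have hBi := hint B hB fun p hp => by simp [B, hD0 _ _ hp]
  have hpath : ∀ (w : ℂ), HasFDerivAt φ (fderiv ℝ φ w) w := fun w =>
    ((hφ.differentiable one_ne_zero) w).hasFDerivAt
  have hAr : ∀ θ, ∫ r in Ioi (0 : ℝ), A (r, θ) = φ z := by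
    intro θ
    have hd : ∀ r : ℝ, HasDerivAt (fun r : ℝ => φ (z - r * e θ)) (-A (r, θ)) r := by
      intro r
      have h1 : HasDerivAt (fun r : ℝ => z - r * e θ) (-e θ) r := by
        simpa using ((hasDerivAt_id r).ofReal_comp.mul_const (e θ)).const_sub z
      exact ((hpath _).comp_hasDerivAt r h1).congr_deriv (by simp [A])
    have hcs : HasCompactSupport (fun r : ℝ => φ (z - r * e θ)) := by
      refine HasCompactSupport.intro (isCompact_Icc (a := -R) (b := R)) fun r hr => ?_
      refine image_eq_zero_of_notMem_tsupport (hout r θ ?_)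
      by_contra hle
      exact hr (abs_le.1 (not_lt.1 hle))
    have hcd : ContDiff ℝ 1 (fun r : ℝ => φ (z - r * e θ)) := by
      refine hφ.comp (contDiff_const.sub ?_)
      exact (ofRealCLM.contDiff).mul contDiff_const
    have h := hcs.integral_Ioi_deriv_eq hcd 0
    simp only [fun r => (hd r).deriv, integral_neg, ofReal_zero, zero_mul, sub_zero] at h
    exact neg_injective h
  have hBθ : ∀ r ∈ Ioi (0 : ℝ), ∫ θ in Ioo (-Real.pi) Real.pi, B (r, θ) = 0 := by
    intro r hr
    have hr0 : (r : ℂ) ≠ 0 := by exact_mod_cast (ne_of_gt hr)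
    have hd : ∀ θ : ℝ, HasDerivAt (fun θ : ℝ => I * φ (z - r * e θ)) (-(r * B (r, θ))) θ := by
      intro θ
      have h1 : HasDerivAt (fun θ : ℝ => z - r * e θ) (-(r * (I * e θ))) θ :=
        ((hed θ).const_mul (r : ℂ)).const_sub z
      have h2 := ((hpath _).comp_hasDerivAt θ h1).const_mul I
      refine h2.congr_deriv ?_
      have h3 : (r : ℂ) * (I * e θ) = r • (I * e θ) := by simp
      rw [h3, map_neg, map_smul]
      simp [B]
      ring
    have hcont : Continuous (fun θ : ℝ => -(r * B (r, θ))) := by fun_prop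
    have h := intervalIntegral.integral_eq_sub_of_hasDerivAt (a := -Real.pi) (b := Real.pi)
      (fun θ _ => hd θ) (hcont.intervalIntegrable _ _)
    rw [intervalIntegral.integral_of_le (by linarith [Real.pi_pos]), integral_Ioc_eq_integral_Ioo,
      integral_neg, integral_const_mul] at h
    have h4 : e Real.pi = e (-Real.pi) := by simp [e]
    rw [h4, sub_self, neg_eq_zero, mul_eq_zero] at h
    exact h.resolve_left hr0
  rw [← Complex.integral_comp_polarCoord_symm]
  have hsplit : ∀ p ∈ polarCoord.target,
      p.1 • ((Complex.polarCoord.symm p)⁻¹ * (fderiv ℝ φ (z - Complex.polarCoord.symm p) 1 +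
        I * fderiv ℝ φ (z - Complex.polarCoord.symm p) I)) = A p + B p := by
    rintro ⟨r, θ⟩ ⟨hr, -⟩
    have hr0 : (r : ℂ) ≠ 0 := by exact_mod_cast (ne_of_gt hr)
    have he0 : e θ ≠ 0 := fun h => by simpa [h] using hen θ
    rw [Complex.polarCoord_symm_apply]
    simp only [A, B]
    change r • (((r : ℂ) * e θ)⁻¹ * (fderiv ℝ φ (z - r * e θ) 1 +
      I * fderiv ℝ φ (z - r * e θ) I)) = _
    generalize fderiv ℝ φ (z - r * e θ) = L
    have h1 : L (e θ) = Real.cos θ * L 1 + Real.sin θ * L I := by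
      have : e θ = Real.cos θ • (1 : ℂ) + Real.sin θ • I := by simp [e]
      rw [this, map_add, map_smul, map_smul]
      simp
    have h2 : L (I * e θ) = -Real.sin θ * L 1 + Real.cos θ * L I := by
      have : I * e θ = (-Real.sin θ) • (1 : ℂ) + Real.cos θ • I := by
        simp only [e, real_smul]
        push_cast
        linear_combination Complex.sin θ * I_sq
      rw [this, map_add, map_smul, map_smul]
      simp
    have h3 : (e θ)⁻¹ = Real.cos θ - Real.sin θ * I := by
      refine inv_eq_of_mul_eq_one_right ?_
      simp only [e]
      push_cast
      linear_combination (-Complex.sin θ ^ 2) * I_sq + Complex.sin_sq_add_cos_sq θ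
    rw [h1, h2, mul_inv, h3, real_smul]
    field_simp
    linear_combination (-Real.sin θ * L I) * I_sq
  have hms : MeasurableSet polarCoord.target := polarCoord.open_target.measurableSet
  rw [setIntegral_congr_fun hms hsplit]
  have ht : polarCoord.target = Ioi (0 : ℝ) ×ˢ Ioo (-Real.pi) Real.pi := rfl
  rw [ht, Measure.volume_eq_prod, integral_add hAi hBi, setIntegral_prod B hBi,
    setIntegral_congr_fun measurableSet_Ioi hBθ, integral_zero, add_zero, ← Measure.prod_restrict,
    integral_prod_symm A (by rw [Measure.prod_restrict]; exact hAi)]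
  simp only [hAr, integral_const, measureReal_restrict_apply_univ, Real.volume_real_Ioo,
    sub_neg_eq_add, real_smul]
  rw [max_eq_left (by positivity)]
  push_cast
  ring

/-- The Cauchy transform solves the inhomogeneous Cauchy–Riemann equation `∂u/∂z̄ = φ` for
compactly supported continuously differentiable `φ`. -/
theorem hasDbarAt_cauchyTransform {φ : ℂ → ℂ} (hφ : ContDiff ℝ 1 φ) (hc : HasCompactSupport φ)
    (z : ℂ) : HasDbarAt (cauchyTransform φ) (φ z) z := by
  have h := hc.hasFDerivAt_convolution_right (ContinuousLinearMap.mul ℝ ℂ)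
    locallyIntegrable_inv_complex hφ z
  have hpi : (Real.pi : ℂ) ≠ 0 := by exact_mod_cast Real.pi_ne_zero
  have key : HasDbarAt (convolution (fun z : ℂ => z⁻¹) φ (ContinuousLinearMap.mul ℝ ℂ) volume)
      (Real.pi * φ z) z := by
    refine ⟨_, h, ?_⟩
    have hDc : Continuous (fderiv ℝ φ) := hφ.continuous_fderiv one_ne_zero
    have hex := (hc.fderiv ℝ).convolutionExists_right
      ((ContinuousLinearMap.mul ℝ ℂ).precompR ℂ) locallyIntegrable_inv_complex hDc z
    have happ : ∀ w : ℂ, (convolution (fun z : ℂ => z⁻¹) (fderiv ℝ φ)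
        ((ContinuousLinearMap.mul ℝ ℂ).precompR ℂ) volume z) w =
        ∫ ζ : ℂ, ζ⁻¹ * fderiv ℝ φ (z - ζ) w := fun w => by
      rw [convolution_def, ContinuousLinearMap.integral_apply hex]
      rfl
    have hi : ∀ w : ℂ, Integrable fun ζ : ℂ => ζ⁻¹ * fderiv ℝ φ (z - ζ) w := fun w =>
      Integrable.apply_continuousLinearMap hex w
    rw [happ, happ, ← integral_const_mul, ← integral_add (hi 1) ((hi I).const_mul I),
      ← mul_assoc, ← integral_inv_mul_wirtinger hφ hc z]
    congr 1
    ext ζ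
    ring
  have := key.const_mul (Real.pi : ℂ)⁻¹
  rwa [inv_mul_cancel_left₀ hpi] at this

theorem norm_cauchyTransform_le {φ φ₀ : ℂ → ℂ} {z : ℂ} {δ C : ℝ} (hδ : 0 < δ) (hC : 0 ≤ C)
    (hφ₀ : Integrable φ₀) (hle : ∀ ζ, ‖φ ζ‖ ≤ C * ‖φ₀ ζ‖)
    (hsep : ∀ ζ, φ ζ ≠ 0 → δ ≤ ‖z - ζ‖) :
    ‖cauchyTransform φ z‖ ≤ C * (δ⁻¹ * ∫ ζ, ‖φ₀ ζ‖) := by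
  have h1 : ‖∫ ζ : ℂ, ζ⁻¹ * φ (z - ζ)‖ ≤ ∫ ζ, C * δ⁻¹ * ‖φ₀ ζ‖ := by
    have h2 : ∫ ζ : ℂ, ζ⁻¹ * φ (z - ζ) = ∫ ζ : ℂ, (z - ζ)⁻¹ * φ ζ := by
      rw [← integral_sub_left_eq_self _ volume z]
      simp
    rw [h2]
    refine norm_integral_le_of_norm_le (hφ₀.norm.const_mul _) (Eventually.of_forall fun ζ => ?_)
    by_cases hζ : φ ζ = 0
    · simp only [hζ, mul_zero, norm_zero]
      positivity
    · rw [norm_mul, norm_inv]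
      calc ‖z - ζ‖⁻¹ * ‖φ ζ‖ ≤ δ⁻¹ * (C * ‖φ₀ ζ‖) := by
            gcongr
            · exact hsep ζ hζ
            · exact hle ζ
        _ = C * δ⁻¹ * ‖φ₀ ζ‖ := by ring
  rw [integral_const_mul] at h1
  rw [cauchyTransform, norm_mul, norm_inv, norm_real, Real.norm_of_nonneg Real.pi_pos.le]
  have hpi : Real.pi⁻¹ ≤ 1 := inv_le_one_of_one_le₀ (by linarith [Real.pi_gt_three])
  calc _ ≤ 1 * (C * δ⁻¹ * ∫ ζ, ‖φ₀ ζ‖) := by gcongr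
    _ = _ := by ring

theorem contDiff_of_tsupport_subset {U : Set ℂ} (hU : IsOpen U) {f : ℂ → ℂ}
    (hf : ContDiffOn ℝ 1 f U) (h : tsupport f ⊆ U) : ContDiff ℝ 1 f := by
  rw [contDiff_iff_contDiffAt]
  intro z
  by_cases hz : z ∈ tsupport f
  · exact hf.contDiffAt (hU.mem_nhds (h hz))
  · exact contDiffAt_const.congr_of_eventuallyEq (notMem_tsupport_iff_eventuallyEq.1 hz)

/-- If `2 * ‖h‖ ≤ ‖h ζ‖` on `K` for every `ζ` in the support of `φ`, then `∂v/∂z̄ = φ` has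
solutions which are arbitrarily small on `K`. -/
theorem exists_hasDbarAt_norm_le {U K : Set ℂ} (hU : IsOpen U) {φ h : ℂ → ℂ}
    (hφ : ContDiff ℝ 1 φ) (hc : HasCompactSupport φ) (hφU : tsupport φ ⊆ U)
    (hh : DifferentiableOn ℂ h U) (h0 : ∀ ζ ∈ tsupport φ, h ζ ≠ 0) {δ : ℝ} (hδ : 0 < δ)
    (hsep : ∀ z ∈ K, ∀ ζ ∈ tsupport φ, δ ≤ ‖z - ζ‖)
    (hle : ∀ z ∈ K, ∀ ζ ∈ tsupport φ, 2 * ‖h z‖ ≤ ‖h ζ‖) {ε : ℝ} (hε : 0 < ε) :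
    ∃ v : ℂ → ℂ, (∀ z ∈ U, HasDbarAt v (φ z) z) ∧ ∀ z ∈ K, ‖v z‖ ≤ ε := by
  have hφi : Integrable φ := hφ.continuous.integrable_of_hasCompactSupport hc
  obtain ⟨N, hN⟩ : ∃ N : ℕ, (2⁻¹ : ℝ) ^ N * (δ⁻¹ * ∫ ζ, ‖φ ζ‖) ≤ ε := by
    have ht := (tendsto_pow_atTop_nhds_zero_of_lt_one (r := (2⁻¹ : ℝ)) (by norm_num)
      (by norm_num)).mul_const (δ⁻¹ * ∫ ζ, ‖φ ζ‖)
    rw [zero_mul] at ht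
    exact (ht.eventually_le_const hε).exists
  let ψ : ℂ → ℂ := fun ζ => (h ζ ^ N)⁻¹ * φ ζ
  have hψt : tsupport ψ ⊆ tsupport φ := tsupport_mul_subset_right
  have hψ : ContDiff ℝ 1 ψ := by
    rw [contDiff_iff_contDiffAt]
    intro z
    by_cases hz : z ∈ tsupport φ
    · have h1 : ContDiffAt ℝ 1 h z :=
        ((hh.contDiffOn hU).contDiffAt (hU.mem_nhds (hφU hz))).restrict_scalars ℝ
      exact ((h1.pow N).inv (pow_ne_zero _ (h0 z hz))).mul hφ.contDiffAt
    · exact contDiffAt_const.congr_of_eventuallyEq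
        (notMem_tsupport_iff_eventuallyEq.1 fun hz' => hz (hψt hz'))
  have hψc : HasCompactSupport ψ := hc.mul_left
  refine ⟨fun z => h z ^ N * cauchyTransform ψ z, fun z hz => ?_, fun z hz => ?_⟩
  · have hd : HasDbarAt (fun z => h z ^ N) 0 z :=
      HasDbarAt.zero_iff.2 ((hh.differentiableAt (hU.mem_nhds hz)).pow N)
    have hm := hd.mul (hasDbarAt_cauchyTransform hψ hψc z)
    rw [zero_mul, add_zero] at hm
    convert! hm using 1
    by_cases hz' : z ∈ tsupport φ
    · exact (mul_inv_cancel_left₀ (pow_ne_zero _ (h0 z hz')) _).symm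
    · simp [ψ, image_eq_zero_of_notMem_tsupport hz']
  · change ‖h z ^ N * cauchyTransform ψ z‖ ≤ ε
    have he : h z ^ N * cauchyTransform ψ z = cauchyTransform (fun ζ => h z ^ N * ψ ζ) z := by
      simp only [cauchyTransform, mul_left_comm _ (h z ^ N), integral_const_mul]
    rw [he]
    refine (norm_cauchyTransform_le hδ (by positivity) hφi (C := 2⁻¹ ^ N) (fun ζ => ?_)
      (fun ζ hζ => ?_)).trans hN
    · by_cases hζ : ζ ∈ tsupport φ
      · have hp : 0 < ‖h ζ‖ := norm_pos_iff.2 (h0 ζ hζ)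
        have hr : ‖h z‖ * ‖h ζ‖⁻¹ ≤ 2⁻¹ := by
          rw [← div_eq_mul_inv, div_le_iff₀ hp]
          linarith [hle z hz ζ hζ]
        simp only [ψ, norm_mul, norm_inv, norm_pow]
        calc ‖h z‖ ^ N * ((‖h ζ‖ ^ N)⁻¹ * ‖φ ζ‖) = (‖h z‖ * ‖h ζ‖⁻¹) ^ N * ‖φ ζ‖ := by
              rw [mul_pow, inv_pow, mul_assoc]
          _ ≤ _ := by gcongr
      · simp [ψ, image_eq_zero_of_notMem_tsupport hζ]
    · refine hsep z hz ζ (subset_closure fun h' => hζ ?_)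
      simp [ψ, h']

/-- An exhaustion of the open set `U` by compact sets. -/
def exhaustion (U : Set ℂ) (j : ℕ) : Set ℂ :=
  {z | ‖z‖ ≤ 2 ^ j ∧ ∀ s ∉ U, (2 ^ j)⁻¹ ≤ ‖z - s‖}

section exhaustion

variable {U : Set ℂ}

theorem exhaustion_subset (j : ℕ) : exhaustion U j ⊆ U := by
  intro z hz
  by_contra h
  have := hz.2 z h
  rw [sub_self, norm_zero] at this
  exact absurd this (not_le.2 (by positivity))

theorem isClosed_exhaustion (j : ℕ) : IsClosed (exhaustion U j) := by
  simp only [exhaustion, ofPred_and, ofPred_forall]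
  refine (isClosed_le (by fun_prop) (by fun_prop)).inter ?_
  exact isClosed_iInter fun s => isClosed_iInter fun _ =>
    isClosed_le (by fun_prop) (by fun_prop)

theorem isCompact_exhaustion (j : ℕ) : IsCompact (exhaustion U j) :=
  (isCompact_closedBall (0 : ℂ) (2 ^ j)).of_isClosed_subset (isClosed_exhaustion j)
    fun _ hz => mem_closedBall_zero_iff.2 hz.1

theorem exhaustion_subset_interior (j : ℕ) :
    exhaustion U j ⊆ interior (exhaustion U (j + 1)) := by
  intro z hz
  rw [mem_interior_iff_mem_nhds]
  filter_upwards [Metric.ball_mem_nhds z (show (0 : ℝ) < (2 ^ (j + 1))⁻¹ by positivity)] with w hw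
  rw [mem_ball_iff_norm] at hw
  have h1 : (1 : ℝ) ≤ 2 ^ j := one_le_pow₀ (by norm_num)
  have h2 : ((2 : ℝ) ^ (j + 1))⁻¹ ≤ 1 := inv_le_one_of_one_le₀ (one_le_pow₀ (by norm_num))
  have h3 : ((2 : ℝ) ^ j)⁻¹ = 2 * (2 ^ (j + 1))⁻¹ := by
    rw [pow_succ]
    field_simp
  refine ⟨?_, fun s hs => ?_⟩
  · have := norm_le_norm_add_norm_sub' w z
    rw [pow_succ]
    linarith [hz.1]
  · have := norm_sub_le_norm_sub_add_norm_sub z w s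
    rw [norm_sub_rev z w] at this
    linarith [hz.2 s hs]

theorem exhaustion_mono : Monotone (exhaustion U) :=
  monotone_nat_of_le_succ fun j => (exhaustion_subset_interior j).trans interior_subset

theorem exists_mem_exhaustion (hU : IsOpen U) {z : ℂ} (hz : z ∈ U) : ∃ j, z ∈ exhaustion U j := by
  obtain ⟨r, hr, hball⟩ := Metric.isOpen_iff.1 hU z hz
  have ht : Tendsto (fun j : ℕ => (2 : ℝ) ^ j) atTop atTop :=
    tendsto_pow_atTop_atTop_of_one_lt (by norm_num)
  obtain ⟨j, hj1, hj2⟩ := ((ht.eventually_ge_atTop ‖z‖).and (ht.eventually_ge_atTop r⁻¹)).exists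
  refine ⟨j, hj1, fun s hs => ?_⟩
  by_contra h
  rw [not_le] at h
  refine hs (hball ?_)
  rw [mem_ball_iff_norm']
  exact h.trans_le (inv_le_of_inv_le₀ hr hj2)

end exhaustion

theorem exists_hasDbarAt_norm_le_exhaustion {U : Set ℂ} (hU : IsOpen U) {φ : ℂ → ℂ}
    (hφ : ContDiff ℝ 1 φ) (hc : HasCompactSupport φ) (hφU : tsupport φ ⊆ U) (j : ℕ)
    (hd : Disjoint (tsupport φ) (exhaustion U (j + 1))) {ε : ℝ} (hε : 0 < ε) :
    ∃ v : ℂ → ℂ, (∀ z ∈ U, HasDbarAt v (φ z) z) ∧ ∀ z ∈ exhaustion U j, ‖v z‖ ≤ ε := by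
  have hloc : ∀ x : tsupport φ, ∃ O : Set ℂ, IsOpen O ∧ (x : ℂ) ∈ O ∧ ∃ h : ℂ → ℂ,
      DifferentiableOn ℂ h U ∧ (∀ ζ ∈ O ∩ U, h ζ ≠ 0) ∧ ∃ δ > 0,
      (∀ z ∈ exhaustion U j, ∀ ζ ∈ O ∩ U, δ ≤ ‖z - ζ‖) ∧
      (∀ z ∈ exhaustion U j, ∀ ζ ∈ O ∩ U, 2 * ‖h z‖ ≤ ‖h ζ‖) := by
    rintro ⟨x, hx⟩
    have hx' := disjoint_left.1 hd hx
    rw [exhaustion, mem_ofPred_eq, not_and_or, not_le] at hx'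
    rcases hx' with hx' | hx'
    · refine ⟨{ζ | 2 ^ (j + 1) < ‖ζ‖}, isOpen_lt (by fun_prop) (by fun_prop), hx', id,
        differentiableOn_id, ?_, 2 ^ j, by positivity, ?_, ?_⟩
      · rintro ζ ⟨hζ, -⟩ hz
        rw [mem_ofPred_eq, show ζ = 0 from hz, norm_zero] at hζ
        exact absurd hζ (not_lt.2 (by positivity))
      · rintro z hz ζ ⟨hζ, -⟩
        rw [mem_ofPred_eq, pow_succ] at hζ
        have := norm_le_norm_add_norm_sub z ζ
        linarith [hz.1]
      · rintro z hz ζ ⟨hζ, -⟩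
        rw [mem_ofPred_eq, pow_succ] at hζ
        simp only [id]
        linarith [hz.1]
    · push Not at hx'
      obtain ⟨s, hs, hx'⟩ := hx'
      have h3 : ((2 : ℝ) ^ j)⁻¹ = 2 * (2 ^ (j + 1))⁻¹ := by
        rw [pow_succ]
        field_simp
      have hne : ∀ z ∈ U, z - s ≠ 0 := fun z hz h => hs (sub_eq_zero.1 h ▸ hz)
      refine ⟨{ζ | ‖ζ - s‖ < (2 ^ (j + 1))⁻¹}, isOpen_lt (by fun_prop) (by fun_prop), hx',
        fun z => (z - s)⁻¹, ?_, fun ζ hζ => inv_ne_zero (hne ζ hζ.2), (2 ^ (j + 1))⁻¹,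
        by positivity, ?_, ?_⟩
      · exact (differentiableOn_id.sub_const s).inv hne
      · rintro z hz ζ ⟨hζ, -⟩
        rw [mem_ofPred_eq] at hζ
        have := norm_sub_le_norm_sub_add_norm_sub z ζ s
        linarith [hz.2 s hs]
      · rintro z hz ζ ⟨hζ, hζU⟩
        rw [mem_ofPred_eq] at hζ
        have hp : 0 < ‖ζ - s‖ := norm_pos_iff.2 (hne ζ hζU)
        have h4 : 2 * ‖ζ - s‖ ≤ ‖z - s‖ := by linarith [hz.2 s hs]
        rw [norm_inv, norm_inv]
        calc 2 * ‖z - s‖⁻¹ ≤ 2 * (2 * ‖ζ - s‖)⁻¹ := by gcongr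
          _ = ‖ζ - s‖⁻¹ := by
            rw [mul_inv]
            ring
  choose O hO hxO h hh h0 δ hδ hsep hle using hloc
  obtain ⟨t, ht⟩ := IsCompact.elim_finite_subcover hc O hO
    fun x hx => mem_iUnion.2 ⟨⟨x, hx⟩, hxO _⟩
  obtain ⟨ρ, hρ⟩ := SmoothPartitionOfUnity.exists_isSubordinate 𝓘(ℝ, ℂ) (isClosed_tsupport φ)
    (fun i : t => O i) (fun i => hO i) (by simpa [iUnion_subtype] using ht)
  have hρs : ∀ i, ContDiff ℝ 1 (fun z => (ρ i z : ℂ)) := fun i =>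
    ofRealCLM.contDiff.comp (((ρ i).contMDiff.contDiff).of_le (by exact_mod_cast le_top))
  have hts : ∀ i, tsupport (fun z => (ρ i z : ℂ) * φ z) ⊆ tsupport φ := fun i =>
    tsupport_mul_subset_right
  have hts' : ∀ i : t, tsupport (fun z => (ρ i z : ℂ) * φ z) ⊆ O i ∩ U := fun i =>
    subset_inter ((tsupport_mul_subset_left.trans
      (closure_mono fun z hz => by simpa using hz)).trans (hρ i)) ((hts i).trans hφU)
  have hex := fun i : t => exists_hasDbarAt_norm_le (K := exhaustion U j) hU
    ((hρs i).mul hφ) hc.mul_left ((hts i).trans hφU) (hh i) (fun ζ hζ => h0 i ζ (hts' i hζ)) (hδ i)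
    (fun z hz ζ hζ => hsep i z hz ζ (hts' i hζ)) (fun z hz ζ hζ => hle i z hz ζ (hts' i hζ))
    (ε := ε / (Fintype.card t + 1)) (by positivity)
  choose v hv hvε using hex
  refine ⟨fun z => ∑ i, v i z, fun z hz => ?_, fun z hz => ?_⟩
  · convert! HasDbarAt.sum (s := Finset.univ) fun i _ => hv i z hz using 1
    rw [← Finset.sum_mul]
    by_cases hz' : z ∈ tsupport φ
    · have h1 := ρ.sum_eq_one hz'
      rw [finsum_eq_sum_of_fintype] at h1
      have h2 : ∑ i, (ρ i z : ℂ) = 1 := by exact_mod_cast h1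
      rw [h2, one_mul]
    · rw [image_eq_zero_of_notMem_tsupport hz', mul_zero]
  · refine (norm_sum_le_of_le _ fun i _ => hvε i z hz).trans ?_
    rw [Finset.sum_const, nsmul_eq_mul, Finset.card_univ, ← mul_div_assoc,
      div_le_iff₀ (by positivity)]
    nlinarith

/-- The inhomogeneous Cauchy–Riemann equation `∂u/∂z̄ = φ` is solvable on every open subset of the
plane. -/
theorem exists_hasDbarAt {U : Set ℂ} (hU : IsOpen U) {φ : ℂ → ℂ} (hφ : ContDiffOn ℝ 1 φ U) :
    ∃ u : ℂ → ℂ, ∀ z ∈ U, HasDbarAt u (φ z) z := by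
  have hcut := fun j : ℕ => exists_contMDiffMap_one_nhds_of_subset_interior (n := 1) 𝓘(ℝ, ℂ)
    (isClosed_exhaustion (j + 2)) (exhaustion_subset_interior (U := U) (j + 2))
  choose η hη1 hη0 _ using hcut
  let ψ : ℕ → ℂ → ℂ := fun j z => (η j z : ℂ) * φ z
  have hψ1 : ∀ j, ∀ z ∈ exhaustion U (j + 2), ψ j z = φ z := fun j z hz => by
    simp [ψ, (hη1 j).self_of_nhdsSet z hz]
  have hψt : ∀ j, tsupport (ψ j) ⊆ exhaustion U (j + 3) := fun j =>
    closure_minimal (fun z hz => by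
      by_contra h
      exact hz (by simp [ψ, hη0 j z h])) (isClosed_exhaustion _)
  have hψc : ∀ j, HasCompactSupport (ψ j) := fun j =>
    (isCompact_exhaustion (j + 3)).of_isClosed_subset (isClosed_tsupport _) (hψt j)
  have hψs : ∀ j, ContDiff ℝ 1 (ψ j) := fun j =>
    contDiff_of_tsupport_subset hU
      ((ofRealCLM.contDiff.comp (η j).contMDiff.contDiff).contDiffOn.mul hφ)
      ((hψt j).trans (exhaustion_subset _))
  have hdt : ∀ j, tsupport (fun z => ψ (j + 1) z - ψ j z) ⊆ exhaustion U (j + 4) := fun j =>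
    (tsupport_sub _ _).trans (union_subset (hψt (j + 1))
      ((hψt j).trans (exhaustion_mono (Nat.le_succ _))))
  have hd0 : ∀ j, ∀ z ∈ exhaustion U (j + 2), ψ (j + 1) z - ψ j z = 0 := fun j z hz => by
    rw [hψ1 j z hz, hψ1 (j + 1) z (exhaustion_mono (Nat.le_succ _) hz), sub_self]
  have hex := fun j : ℕ => exists_hasDbarAt_norm_le_exhaustion hU ((hψs (j + 1)).sub (hψs j))
    ((hψc (j + 1)).sub (hψc j)) ((hdt j).trans (exhaustion_subset _)) j
    (disjoint_left.2 fun z hz hz' => by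
      refine notMem_tsupport_iff_eventuallyEq.2 ?_ hz
      filter_upwards [mem_interior_iff_mem_nhds.1 (exhaustion_subset_interior _ hz')] with w hw
      exact hd0 j w hw) (ε := (1 / 2) ^ j) (by positivity)
  choose v hv hvε using hex
  refine ⟨fun z => cauchyTransform (ψ 0) z + ∑' j, v j z, fun z hz => ?_⟩
  obtain ⟨m, hm⟩ := exists_mem_exhaustion hU hz
  replace hm := exhaustion_subset_interior m hm
  set V := interior (exhaustion U (m + 1)) with hV
  have hVU : V ⊆ U := interior_subset.trans (exhaustion_subset _)
  have hVm : ∀ j, V ⊆ exhaustion U (j + (m + 1)) := fun j =>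
    interior_subset.trans (exhaustion_mono (Nat.le_add_left _ _))
  have hsum : ∀ w ∈ V, Summable fun j => v (j + (m + 1)) w := fun w hw =>
    Summable.of_norm_bounded ((summable_nat_add_iff (m + 1)).2 summable_geometric_two)
      fun j => hvε _ w (hVm j hw)
  have htail : DifferentiableOn ℂ (fun w => ∑' j, v (j + (m + 1)) w) V := by
    refine differentiableOn_tsum_of_summable_norm
      ((summable_nat_add_iff (m + 1)).2 summable_geometric_two) (fun j w hw => ?_) isOpen_interior
      fun j w hw => hvε _ w (hVm j hw)
    have h := hv (j + (m + 1)) w (hVU hw)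
    simp only [hd0 _ w (exhaustion_mono (Nat.le_add_right _ 2) (hVm j hw))] at h
    exact (HasDbarAt.zero_iff.1 h).differentiableWithinAt
  have hzV : V ∈ 𝓝 z := isOpen_interior.mem_nhds hm
  have h1 := (hasDbarAt_cauchyTransform (hψs 0) (hψc 0) z).add
    ((HasDbarAt.sum (s := Finset.range (m + 1)) fun j _ => hv j z hz).add
      (HasDbarAt.zero_iff.2 (htail.differentiableAt hzV)))
  have h2 : ψ 0 z + (∑ j ∈ Finset.range (m + 1), (ψ (j + 1) z - ψ j z) + 0) = φ z := by
    rw [Finset.sum_range_sub (fun j => ψ j z), add_zero, add_sub_cancel]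
    exact hψ1 _ z (exhaustion_mono (Nat.le_add_right _ 2) (interior_subset hm))
  rw [h2] at h1
  have h3 : ∀ w ∈ V, ∑' j, v j w =
      ∑ j ∈ Finset.range (m + 1), v j w + ∑' j, v (j + (m + 1)) w := fun w hw =>
    (Summable.sum_add_tsum_nat_add (m + 1)
      ((summable_nat_add_iff (f := fun j => v j w) (m + 1)).1 (hsum w hw))).symm
  refine h1.congr_of_eventuallyEq ?_
  filter_upwards [hzV] with w hw
  rw [h3 w hw]

/-- The additive Cousin problem for two open sets: a holomorphic function on `V ∩ W` is the sum of
a holomorphic function on `V` and a holomorphic function on `W`. -/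
theorem exists_eqOn_add_of_differentiableOn_inter {V W : Set ℂ} (hV : IsOpen V) (hW : IsOpen W)
    {f : ℂ → ℂ} (hf : DifferentiableOn ℂ f (V ∩ W)) :
    ∃ g h : ℂ → ℂ, DifferentiableOn ℂ g V ∧ DifferentiableOn ℂ h W ∧
      EqOn f (fun z => g z + h z) (V ∩ W) := by
  obtain ⟨a, ha, has, har⟩ := hV.exists_contDiff_support_eq (n := 2)
  obtain ⟨b, hb, hbs, hbr⟩ := hW.exists_contDiff_support_eq (n := 2)
  have ha0 : ∀ z, 0 ≤ a z := fun z => (har (mem_range_self z)).1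
  have hb0 : ∀ z, 0 ≤ b z := fun z => (hbr (mem_range_self z)).1
  have haV : ∀ z, z ∉ V → a z = 0 := fun z hz => by rwa [← ha, Function.notMem_support] at hz
  have hbW : ∀ z, z ∉ W → b z = 0 := fun z hz => by rwa [← hb, Function.notMem_support] at hz
  have hab : ∀ z ∈ V ∪ W, a z + b z ≠ 0 := by
    rintro z (hz | hz)
    · rw [← ha, Function.mem_support] at hz
      exact (add_pos_of_pos_of_nonneg ((ha0 z).lt_of_ne' hz) (hb0 z)).ne'
    · rw [← hb, Function.mem_support] at hz
      exact (add_pos_of_nonneg_of_pos (ha0 z) ((hb0 z).lt_of_ne' hz)).ne'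
  have hU : IsOpen (V ∪ W) := hV.union hW
  let τ : ℂ → ℝ := fun z => 3 * (a z / (a z + b z)) - 1
  have hτ : ContDiffOn ℝ 2 τ (V ∪ W) :=
    (contDiffOn_const.mul (has.contDiffOn.div (has.add hbs).contDiffOn hab)).sub contDiffOn_const
  let χ : ℂ → ℂ := fun z => (Real.smoothTransition (τ z) : ℂ)
  have hχ : ContDiffOn ℝ 2 χ (V ∪ W) :=
    (ofRealCLM.contDiff.comp (Real.smoothTransition.contDiff (n := 2))).comp_contDiffOn hτ
  have hτc : ∀ z ∈ V ∪ W, ContinuousAt τ z := fun z hz =>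
    hτ.continuousOn.continuousAt (hU.mem_nhds hz)
  have hχ1 : ∀ z ∈ V, z ∉ W → χ =ᶠ[𝓝 z] fun _ => 1 := fun z hz hzW => by
    have h1 : 1 < τ z := by
      have h2 := hab z (Or.inl hz)
      simp only [τ]
      rw [hbW z hzW, add_zero] at h2 ⊢
      rw [div_self h2]
      norm_num
    filter_upwards [(hτc z (Or.inl hz)).eventually_const_lt h1] with w hw
    simp [χ, Real.smoothTransition.one_of_one_le hw.le]
  have hχ0 : ∀ z ∈ W, z ∉ V → χ =ᶠ[𝓝 z] fun _ => 0 := fun z hz hzV => by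
    have h1 : τ z < 0 := by simp [τ, haV z hzV]
    filter_upwards [(hτc z (Or.inr hz)).eventually_lt_const h1] with w hw
    simp [χ, Real.smoothTransition.zero_of_nonpos hw.le]
  let χ' : ℂ → ℂ := fun z => (fderiv ℝ χ z 1 + I * fderiv ℝ χ z I) / 2
  have hχd : ∀ z ∈ V ∪ W, HasDbarAt χ (χ' z) z := fun z hz =>
    ⟨_, ((hχ.contDiffAt (hU.mem_nhds hz)).differentiableAt two_ne_zero).hasFDerivAt,
      (mul_div_cancel₀ _ two_ne_zero).symm⟩
  have hχ's : ContDiffOn ℝ 1 χ' (V ∪ W) := by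
    have h1 : ContDiffOn ℝ 1 (fderiv ℝ χ) (V ∪ W) := hχ.fderiv_of_isOpen hU (by norm_num)
    exact ((h1.clm_apply contDiffOn_const).add
      (contDiffOn_const.mul (h1.clm_apply contDiffOn_const))).div_const 2
  have hχ'0 : ∀ (z c : ℂ), (χ =ᶠ[𝓝 z] fun _ => c) → χ' =ᶠ[𝓝 z] fun _ => 0 := fun z c h => by
    filter_upwards [h.fderiv (𝕜 := ℝ)] with w hw
    simp [χ', hw]
  have hVW : IsOpen (V ∩ W) := hV.inter hW
  have hφ : ContDiffOn ℝ 1 (fun z => f z * χ' z) (V ∪ W) := by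
    intro z hz
    refine ContDiffAt.contDiffWithinAt ?_
    by_cases hzi : z ∈ V ∩ W
    · exact (((hf.contDiffOn hVW).contDiffAt (hVW.mem_nhds hzi)).restrict_scalars ℝ).mul
        (hχ's.contDiffAt (hU.mem_nhds hz))
    · have h0 : χ' =ᶠ[𝓝 z] fun _ => 0 := by
        by_cases hzV : z ∈ V
        · exact hχ'0 z 1 (hχ1 z hzV fun hzW => hzi ⟨hzV, hzW⟩)
        · exact hχ'0 z 0 (hχ0 z (hz.resolve_left hzV) hzV)
      refine (contDiffAt_const (c := (0 : ℂ))).congr_of_eventuallyEq ?_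
      filter_upwards [h0] with w hw
      rw [hw, mul_zero]
  obtain ⟨u, hu⟩ := exists_hasDbarAt hU hφ
  have hfd : ∀ z ∈ V ∩ W, HasDbarAt f 0 z := fun z hz =>
    HasDbarAt.zero_iff.2 (hf.differentiableAt (hVW.mem_nhds hz))
  refine ⟨fun z => f z * (1 - χ z) + u z, fun z => f z * χ z - u z, fun z hz => ?_,
    fun z hz => ?_, fun z _ => by simp only; ring⟩
  · refine (HasDbarAt.zero_iff.1 ?_).differentiableWithinAt
    by_cases hzW : z ∈ W
    · convert! ((hfd z ⟨hz, hzW⟩).mul ((HasDbarAt.zero_iff.2 (differentiableAt_const 1)).sub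
        (hχd z (Or.inl hz)))).add (hu z (Or.inl hz)) using 1
      ring
    · have h1 := hχ1 z hz hzW
      have h2 := hu z (Or.inl hz)
      rw [(hχ'0 z 1 h1).self_of_nhds, mul_zero] at h2
      refine h2.congr_of_eventuallyEq ?_
      filter_upwards [h1] with w hw
      rw [hw, sub_self, mul_zero, zero_add]
  · refine (HasDbarAt.zero_iff.1 ?_).differentiableWithinAt
    by_cases hzV : z ∈ V
    · convert! ((hfd z ⟨hzV, hz⟩).mul (hχd z (Or.inr hz))).sub (hu z (Or.inr hz)) using 1
      ring
    · have h1 := hχ0 z hz hzV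
      have h2 := hu z (Or.inr hz)
      rw [(hχ'0 z 0 h1).self_of_nhds, mul_zero] at h2
      have h3 := (HasDbarAt.zero_iff.2 (differentiableAt_const 0)).sub h2
      rw [sub_zero] at h3
      refine h3.congr_of_eventuallyEq ?_
      filter_upwards [h1] with w hw
      rw [hw, mul_zero]

end

/-- Let `M ⊆ ℝ` be open and `X' ⊆ X ⊆ ℂ` open with `X ∩ ℝ = X' ∩ ℝ = M`. Then the map
induced by restriction of holomorphic functions is a linear isomorphism
`O(X ∖ M)/O(X) ≅ O(X' ∖ M)/O(X')`: the space of hyperfunctions `B(M)` depends only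
on `M`, not on the choice of the complex neighborhood `X`. -/
theorem hyperfun_independent_of_complex_nbhd (M₀ : Set ℝ) (hM₀ : IsOpen M₀)
    (M : Set ℂ) (hM : M = Complex.ofReal '' M₀)
    (X X' : Set ℂ) (hX : IsOpen X) (hX' : IsOpen X') (hsub : X' ⊆ X)
    (hXR : X ∩ Set.range Complex.ofReal = M)
    (hX'R : X' ∩ Set.range Complex.ofReal = M) :
    ∃ e : Hyperfun X M ≃ₗ[ℂ] Hyperfun X' M,
      ∀ f : ↥(hol (X \ M)),
        e (Submodule.Quotient.mk f) =
          Submodule.Quotient.mk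
            (⟨(f : ℂ → ℂ), f.2.mono fun z hz => ⟨hsub hz.1, hz.2⟩⟩ :
              ↥(hol (X' \ M))) := by
  classical
  have hR : IsClosed (Set.range Complex.ofReal) :=
    Complex.isometry_ofReal.isClosedEmbedding.isClosed_range
  have hXM : X \ M = X ∩ (Set.range Complex.ofReal)ᶜ := by
    rw [← hXR, Set.sdiff_self_inter, Set.sdiff_eq]
  have hWo : IsOpen (X \ M) := hXM ▸ hX.inter hR.isOpen_compl
  have hMX' : M ⊆ X' := hX'R ▸ Set.inter_subset_left
  have hsub' : X' \ M ⊆ X \ M := Set.sdiff_subset_sdiff_left hsub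
  have hinter : X' ∩ (X \ M) = X' \ M := by
    rw [← Set.inter_sdiff_assoc, Set.inter_eq_left.2 hsub]
  let r : ↥(hol (X \ M)) →ₗ[ℂ] ↥(hol (X' \ M)) := Submodule.inclusion fun f hf => hf.mono hsub'
  have hle : holFrom X (X \ M) ≤ (holFrom X' (X' \ M)).comap r := by
    rintro f ⟨g, hg, he⟩
    exact ⟨g, hg.mono hsub, he.mono hsub'⟩
  let φ : Hyperfun X M →ₗ[ℂ] Hyperfun X' M := Submodule.mapQ _ _ r hle
  have hinj : Function.Injective φ := by
    rw [injective_iff_map_eq_zero]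
    intro x hx
    obtain ⟨f, rfl⟩ := Submodule.Quotient.mk_surjective _ x
    obtain ⟨g, hg, he⟩ := (Submodule.Quotient.mk_eq_zero _).1 hx
    refine (Submodule.Quotient.mk_eq_zero _).2 ⟨X'.piecewise g f, fun z hz => ?_, fun z hz => ?_⟩
    · refine DifferentiableAt.differentiableWithinAt ?_
      by_cases hz' : z ∈ X'
      · refine (hg.differentiableAt (hX'.mem_nhds hz')).congr_of_eventuallyEq ?_
        filter_upwards [hX'.mem_nhds hz'] with w hw
        exact Set.piecewise_eq_of_mem _ _ _ hw
      · have hzW : z ∈ X \ M := ⟨hz, fun h => hz' (hMX' h)⟩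
        refine (f.2.differentiableAt (hWo.mem_nhds hzW)).congr_of_eventuallyEq ?_
        filter_upwards [hWo.mem_nhds hzW] with w hw
        by_cases hw' : w ∈ X'
        · rw [Set.piecewise_eq_of_mem _ _ _ hw']
          exact (he ⟨hw', hw.2⟩).symm
        · exact Set.piecewise_eq_of_notMem _ _ _ hw'
    · by_cases hz' : z ∈ X'
      · rw [Set.piecewise_eq_of_mem _ _ _ hz']
        exact he ⟨hz', hz.2⟩
      · rw [Set.piecewise_eq_of_notMem _ _ _ hz']
  have hsurj : Function.Surjective φ := by
    intro y
    obtain ⟨f, rfl⟩ := Submodule.Quotient.mk_surjective _ y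
    obtain ⟨g, h, hg, hh, he⟩ := exists_eqOn_add_of_differentiableOn_inter hX' hWo
      (f := f) (by rw [hinter]; exact f.2)
    rw [hinter] at he
    refine ⟨Submodule.Quotient.mk ⟨h, hh⟩, ?_⟩
    refine (Submodule.Quotient.eq _).2 ⟨-g, hg.neg, fun z hz => ?_⟩
    change h z - (f : ℂ → ℂ) z = -g z
    rw [he hz]
    ring
  exact ⟨LinearEquiv.ofBijective φ ⟨hinj, hsurj⟩, fun f => rfl⟩
end
end

section
/- (Flabbiness of one-dimensional hyperfunctions.) Let U ⊆ ℂ be open, set I = U ∩ ℝ, and let h be holomorphic on U ∖ ℝ. Then there exist a function g holomorphic on ℂ ∖ ℝ, an open set V with I ⊆ V ⊆ U, and a function φ holomorphic on V, such that g(z) = h(z) + φ(z) for all z ∈ V ∖ ℝ. (Thus every hyperfunction on the open set I ⊆ ℝ extends to a hyperfunction on all of ℝ: the restriction morphisms of the sheaf of hyperfunctions are surjective.) -/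
namespace HyperfunctionFlabby

open Complex MeasureTheory Set Filter Topology
open scoped Convolution

/-- `u` is real differentiable at `z`, with `∂u/∂x + i ∂u/∂y = c` there. -/
def HasDbarAt (u : ℂ → ℂ) (c z : ℂ) : Prop :=
  DifferentiableAt ℝ u z ∧ fderiv ℝ u z 1 + I * fderiv ℝ u z I = c

namespace HasDbarAt

variable {u v : ℂ → ℂ} {c d z : ℂ}

theorem add (hu : HasDbarAt u c z) (hv : HasDbarAt v d z) :
    HasDbarAt (fun w ↦ u w + v w) (c + d) z := by
  refine ⟨hu.1.add hv.1, ?_⟩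
  rw [fderiv_fun_add hu.1 hv.1, ← hu.2, ← hv.2]
  simp only [add_apply]
  ring

theorem sub (hu : HasDbarAt u c z) (hv : HasDbarAt v d z) :
    HasDbarAt (fun w ↦ u w - v w) (c - d) z := by
  refine ⟨hu.1.sub hv.1, ?_⟩
  rw [fderiv_fun_sub hu.1 hv.1, ← hu.2, ← hv.2]
  simp only [sub_apply]
  ring

theorem mul (hu : HasDbarAt u c z) (hv : HasDbarAt v d z) :
    HasDbarAt (fun w ↦ u w * v w) (u z * d + v z * c) z := by
  refine ⟨hu.1.mul hv.1, ?_⟩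
  rw [fderiv_fun_mul hu.1 hv.1, ← hu.2, ← hv.2]
  simp only [add_apply, smul_apply, smul_eq_mul]
  ring

theorem congr_of_eventuallyEq (hu : HasDbarAt u c z) (h : v =ᶠ[𝓝 z] u) : HasDbarAt v c z :=
  ⟨hu.1.congr_of_eventuallyEq h, by rw [h.fderiv_eq, hu.2]⟩

theorem zero_iff : HasDbarAt u 0 z ↔ DifferentiableAt ℂ u z := by
  rw [differentiableAt_complex_iff_differentiableAt_real, HasDbarAt, smul_eq_mul]
  refine and_congr_right fun _ ↦ ⟨fun h ↦ ?_, fun h ↦ ?_⟩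
  · linear_combination (-I) * h + fderiv ℝ u z I * I_mul_I
  · rw [h]
    linear_combination fderiv ℝ u z 1 * I_mul_I

theorem sum {ι : Type*} {s : Finset ι} {u : ι → ℂ → ℂ} {c : ι → ℂ}
    (h : ∀ i ∈ s, HasDbarAt (u i) (c i) z) :
    HasDbarAt (fun w ↦ ∑ i ∈ s, u i w) (∑ i ∈ s, c i) z := by
  classical
  induction s using Finset.induction_on with
  | empty => simpa using zero_iff.2 (differentiableAt_const 0)
  | insert a s ha ih =>
    simp only [Finset.sum_insert ha]
    exact (h a (by simp)).add (ih fun i hi ↦ h i (by simp [hi]))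

end HasDbarAt

theorem locallyIntegrable_inv_complex : LocallyIntegrable (fun z : ℂ ↦ z⁻¹) := by
  rw [locallyIntegrable_iff]
  intro k hk
  obtain ⟨R, hR⟩ := hk.isBounded.subset_closedBall 0
  have hmeas : AEStronglyMeasurable (fun z : ℂ ↦ z⁻¹) := measurable_inv.aestronglyMeasurable
  refine IntegrableOn.mono_set ?_ hR
  rw [← integrable_indicator_iff Metric.isClosed_closedBall.measurableSet]
  have key : Integrable (fun z : ℂ ↦ (Iic R).indicator (fun y : ℝ ↦ y⁻¹) ‖z‖) := by
    rw [integrable_fun_norm_addHaar volume (f := (Iic R).indicator (fun y : ℝ ↦ y⁻¹))]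
    have h1 : IntegrableOn ((Iic R).indicator (fun _ : ℝ ↦ (1 : ℝ))) (Ioi 0) := by
      rw [integrableOn_indicator_iff measurableSet_Iic]
      refine (integrableOn_const (s := Icc (0:ℝ) R) (by simp)).mono_set ?_
      rintro x ⟨h1, h2⟩
      exact ⟨le_of_lt h2, h1⟩
    refine h1.congr_fun (fun y hy ↦ ?_) measurableSet_Ioi
    have hy' : y ≠ 0 := ne_of_gt hy
    by_cases h : y ≤ R <;> simp [indicator, h, hy']
  refine key.mono (hmeas.indicator Metric.isClosed_closedBall.measurableSet) ?_
  filter_upwards with z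
  by_cases h : ‖z‖ ≤ R <;> simp [indicator, h]

theorem dbar_clm_eq_of_norm_eq_one (L : ℂ →L[ℝ] ℂ) {e : ℂ} (he : ‖e‖ = 1) :
    L 1 + I * L I = e * (L e + I * L (I * e)) := by
  have h : (e.re : ℂ) ^ 2 + (e.im : ℂ) ^ 2 = 1 := by
    have := Complex.sq_norm e
    rw [he, normSq_apply] at this
    exact_mod_cast (by linarith : e.re ^ 2 + e.im ^ 2 = 1)
  have e1 : L e = e.re • L 1 + e.im • L I := by
    rw [← map_smul, ← map_smul, ← map_add]
    congr 1
    simp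
  have e2 : L (I * e) = e.re • L I + (-e.im) • L 1 := by
    rw [← map_smul, ← map_smul, ← map_add]
    congr 1
    apply Complex.ext <;> simp
  rw [e1, e2]
  simp only [real_smul, ofReal_neg]
  linear_combination (-(L 1) - I * L I) * h +
    ((e.im : ℂ) ^ 2 * L 1 - e.re * e.im * L I) * I_mul_I +
    (e.re * L 1 + e.im * L I + I * (e.re * L I - e.im * L 1)) * re_add_im e

/-- The Cauchy–Pompeiu formula for compactly supported functions. -/
theorem integral_inv_mul_dbar {F : ℂ → ℂ} (hF : ContDiff ℝ 1 F) (hc : HasCompactSupport F)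
    (z : ℂ) :
    ∫ w, w⁻¹ * (fderiv ℝ F (z - w) 1 + I * fderiv ℝ F (z - w) I) = 2 * Real.pi * F z := by
  set e : ℝ → ℂ := fun θ ↦ Real.cos θ + Real.sin θ * I with he
  have hec : Continuous e := by fun_prop
  have hederiv : ∀ θ, HasDerivAt e (I * e θ) θ := by
    intro θ
    have h1 := (Real.hasDerivAt_cos θ).ofReal_comp
    have h2 := ((Real.hasDerivAt_sin θ).ofReal_comp).mul_const I
    refine (h1.add h2).congr_deriv ?_
    simp only [he]
    push_cast
    linear_combination -(Complex.sin θ) * I_mul_I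
  have henorm : ∀ θ, ‖e θ‖ = 1 := fun θ ↦ by
    simp [he]
  have hdF : Continuous (fderiv ℝ F) := hF.continuous_fderiv one_ne_zero
  have hFd : Differentiable ℝ F := hF.differentiable one_ne_zero
  obtain ⟨R, hR⟩ : ∃ R : ℝ, ∀ w, R < ‖w‖ → w ∉ tsupport F := by
    obtain ⟨R, hR⟩ := hc.isCompact.isBounded.subset_closedBall 0
    refine ⟨R, fun w hw h ↦ ?_⟩
    have := hR h
    simp at this
    linarith
  have hR' : ∀ r θ, ‖z‖ + R < r → z - (r : ℝ) * e θ ∉ tsupport F := by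
    intro r θ hr
    apply hR
    have h1 : ‖(r : ℂ) * e θ‖ = |r| := by simp [henorm]
    have h2 := norm_sub_norm_le ((r : ℂ) * e θ) z
    rw [norm_sub_rev, h1] at h2
    linarith [le_abs_self r]
  set A : ℝ × ℝ → ℂ := fun p ↦ fderiv ℝ F (z - p.1 * e p.2) (e p.2) with hA
  set B : ℝ × ℝ → ℂ := fun p ↦ I * fderiv ℝ F (z - p.1 * e p.2) (I * e p.2) with hB
  have hAc : Continuous A := by
    have : Continuous fun p : ℝ × ℝ ↦ fderiv ℝ F (z - p.1 * e p.2) := hdF.comp (by fun_prop)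
    exact this.clm_apply (by fun_prop)
  have hBc : Continuous B := by
    have : Continuous fun p : ℝ × ℝ ↦ fderiv ℝ F (z - p.1 * e p.2) := hdF.comp (by fun_prop)
    exact continuous_const.mul (this.clm_apply (by fun_prop))
  have hint : ∀ C : ℝ × ℝ → ℂ, Continuous C →
      (∀ p : ℝ × ℝ, ‖z‖ + R < p.1 → C p = 0) →
      IntegrableOn C (Ioi (0 : ℝ) ×ˢ Ioo (-Real.pi) Real.pi) (volume.prod volume) := by
    intro C hC h0
    have h1 : IntegrableOn C (Icc 0 (‖z‖ + R) ×ˢ Icc (-Real.pi) Real.pi) (volume.prod volume) :=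
      hC.continuousOn.integrableOn_compact (isCompact_Icc.prod isCompact_Icc)
    refine h1.of_forall_sdiff_eq_zero (measurableSet_Ioi.prod measurableSet_Ioo) ?_
    rintro ⟨r, θ⟩ ⟨⟨hr, hθ⟩, hn⟩
    apply h0
    by_contra hcon
    exact hn ⟨⟨le_of_lt hr, not_lt.1 hcon⟩, ⟨hθ.1.le, hθ.2.le⟩⟩
  have hd0 : ∀ w, w ∉ tsupport F → fderiv ℝ F w = 0 := fun w hw ↦ by
    by_contra h
    exact hw (support_fderiv_subset ℝ h)
  have hAi := hint A hAc fun p hp ↦ by simp [hA, hd0 _ (hR' p.1 p.2 hp)]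
  have hBi := hint B hBc fun p hp ↦ by simp [hB, hd0 _ (hR' p.1 p.2 hp)]
  rw [← Complex.integral_comp_polarCoord_symm]
  have hstep : ∫ p in polarCoord.target, p.1 • ((Complex.polarCoord.symm p)⁻¹ *
      (fderiv ℝ F (z - Complex.polarCoord.symm p) 1 +
        I * fderiv ℝ F (z - Complex.polarCoord.symm p) I)) =
      ∫ p in Ioi (0 : ℝ) ×ˢ Ioo (-Real.pi) Real.pi, (A p + B p) := by
    refine setIntegral_congr_fun polarCoord.open_target.measurableSet ?_
    rintro ⟨r, θ⟩ ⟨hr, hθ⟩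
    have hr0 : (r : ℂ) ≠ 0 := by exact_mod_cast (ne_of_gt hr : r ≠ 0)
    have he0 : e θ ≠ 0 := by
      rw [← norm_pos_iff, henorm]; exact one_pos
    simp only [Complex.polarCoord_symm_apply, real_smul, hA, hB]
    change _ * ((r * e θ)⁻¹ * (fderiv ℝ F (z - r * e θ) 1 + I * fderiv ℝ F (z - r * e θ) I)) = _
    rw [dbar_clm_eq_of_norm_eq_one _ (henorm θ)]
    field_simp
  rw [hstep, Measure.volume_eq_prod, integral_add hAi hBi, ← Measure.volume_eq_prod]
  have hBz : ∫ p in Ioi (0 : ℝ) ×ˢ Ioo (-Real.pi) Real.pi, B p = 0 := by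
    rw [Measure.volume_eq_prod, setIntegral_prod _ hBi]
    refine setIntegral_eq_zero_of_forall_eq_zero fun r hr ↦ ?_
    have hr0 : (r : ℂ) ≠ 0 := by exact_mod_cast (ne_of_gt hr : r ≠ 0)
    rw [← integral_Ioc_eq_integral_Ioo,
      ← intervalIntegral.integral_of_le (by linarith [Real.pi_pos])]
    have hder : ∀ θ ∈ uIcc (-Real.pi) Real.pi,
        HasDerivAt (fun θ : ℝ ↦ -(I / r) * F (z - r * e θ)) (B (r, θ)) θ := by
      intro θ _
      have h1 : HasDerivAt (fun θ : ℝ ↦ z - r * e θ) (-(r * (I * e θ))) θ :=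
        ((hederiv θ).const_mul (r : ℂ)).const_sub z
      have h2 := ((hFd (z - r * e θ)).hasFDerivAt.comp_hasDerivAt θ h1).const_mul (-(I / r))
      refine h2.congr_deriv ?_
      have h3 : -((r : ℂ) * (I * e θ)) = (-r) • (I * e θ) := by simp
      rw [h3, map_smul]
      simp only [hB, real_smul, ofReal_neg]
      field_simp
    rw [intervalIntegral.integral_eq_sub_of_hasDerivAt hder
      ((hBc.comp (by fun_prop : Continuous fun θ : ℝ ↦ (r, θ))).intervalIntegrable _ _)]
    simp [he]
  have hAz : ∫ p in Ioi (0 : ℝ) ×ˢ Ioo (-Real.pi) Real.pi, A p = 2 * Real.pi * F z := by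
    rw [Measure.volume_eq_prod, setIntegral_prod _ hAi, integral_integral_swap]
    · have hin : ∀ θ, ∫ r in Ioi (0 : ℝ), A (r, θ) = F z := by
        intro θ
        have hder : ∀ r ∈ Ici (0 : ℝ),
            HasDerivAt (fun r : ℝ ↦ -F (z - r * e θ)) (A (r, θ)) r := by
          intro r _
          have h0 : HasDerivAt (fun r : ℝ ↦ (r : ℂ)) 1 r := HasDerivAt.ofReal_comp (hasDerivAt_id r)
          have h1 : HasDerivAt (fun r : ℝ ↦ z - r * e θ) (-(1 * e θ)) r :=
            (h0.mul_const (e θ)).const_sub z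
          have h2 := ((hFd (z - r * e θ)).hasFDerivAt.comp_hasDerivAt r h1).neg
          refine h2.congr_deriv ?_
          simp [hA]
        have hi : IntegrableOn (fun r ↦ A (r, θ)) (Ioi 0) := by
          have h1 : IntegrableOn (fun r ↦ A (r, θ)) (Icc 0 (‖z‖ + R)) :=
            (hAc.comp (by fun_prop : Continuous fun r : ℝ ↦ (r, θ))).continuousOn.integrableOn_Icc
          refine h1.of_forall_sdiff_eq_zero measurableSet_Ioi ?_
          rintro r ⟨hr, hn⟩
          have : ‖z‖ + R < r := by
            by_contra hcon
            exact hn ⟨le_of_lt hr, not_lt.1 hcon⟩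
          simp [hA, hd0 _ (hR' r θ this)]
        have hlim : Tendsto (fun r : ℝ ↦ -F (z - r * e θ)) atTop (𝓝 0) := by
          refine tendsto_const_nhds.congr' ?_
          filter_upwards [eventually_gt_atTop (‖z‖ + R)] with r hr
          rw [image_eq_zero_of_notMem_tsupport (hR' r θ hr), neg_zero]
        rw [integral_Ioi_of_hasDerivAt_of_tendsto' hder hi hlim]
        simp
      simp only [hin]
      rw [setIntegral_const]
      simp only [Measure.real, Real.volume_Ioo, real_smul]
      rw [ENNReal.toReal_ofReal (by linarith [Real.pi_pos])]
      push_cast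
      ring
    · rw [Measure.prod_restrict]
      exact hAi
  rw [hAz, hBz, add_zero]

/-- The Cauchy transform of `F`, the convolution of `F` with `1 / (2πz)`, which is a fundamental
solution of `∂/∂x + i ∂/∂y`. -/
noncomputable def cauchyTransform (F : ℂ → ℂ) (z : ℂ) : ℂ :=
  (2 * Real.pi : ℂ)⁻¹ * ((fun w : ℂ ↦ w⁻¹) ⋆[ContinuousLinearMap.mul ℝ ℂ] F) z

theorem hasDbarAt_cauchyTransform {F : ℂ → ℂ} (hF : ContDiff ℝ 1 F) (hc : HasCompactSupport F)
    (z : ℂ) : HasDbarAt (cauchyTransform F) (F z) z := by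
  have h1 := (hc.hasFDerivAt_convolution_right (ContinuousLinearMap.mul ℝ ℂ)
    locallyIntegrable_inv_complex hF z).const_mul (2 * Real.pi : ℂ)⁻¹
  refine ⟨h1.differentiableAt, ?_⟩
  have hdc := hF.continuous_fderiv one_ne_zero
  have happ : ∀ v : ℂ, fderiv ℝ (cauchyTransform F) z v =
      (2 * Real.pi : ℂ)⁻¹ * ∫ w, w⁻¹ * fderiv ℝ F (z - w) v := by
    intro v
    have h2 : fderiv ℝ (cauchyTransform F) z = _ := h1.fderiv
    rw [h2, smul_apply, convolution_precompR_apply _ locallyIntegrable_inv_complex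
      (hc.fderiv ℝ) hdc]
    rfl
  have hint : ∀ v : ℂ, Integrable fun w : ℂ ↦ w⁻¹ * fderiv ℝ F (z - w) v := by
    intro v
    exact HasCompactSupport.convolutionExists_right (ContinuousLinearMap.mul ℝ ℂ)
      (g := fun w ↦ fderiv ℝ F w v) (hc.fderiv_apply ℝ v) locallyIntegrable_inv_complex
      (hdc.clm_apply continuous_const) z
  have hpi : (2 * Real.pi : ℂ) ≠ 0 := by simp [Real.pi_ne_zero]
  rw [happ, happ, ← mul_assoc, mul_comm I, mul_assoc, ← mul_add, ← integral_const_mul,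
    ← integral_add (hint 1) ((hint I).const_mul I), inv_mul_eq_iff_eq_mul₀ hpi,
    ← integral_inv_mul_dbar hF hc]
  congr 1
  ext w
  ring

theorem exists_norm_cauchyTransform_mul_le {F : ℂ → ℂ} (hF : Continuous F)
    (hc : HasCompactSupport F) {Q : Set ℂ} (hQ : IsCompact Q) :
    ∃ C : ℝ, 0 ≤ C ∧ ∀ (G : ℂ → ℂ) (M : ℝ), 0 ≤ M → (∀ w ∈ tsupport F, ‖G w‖ ≤ M) →
      ∀ z ∈ Q, ‖cauchyTransform (fun w ↦ F w * G w) z‖ ≤ C * M := by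
  have hli : LocallyIntegrable fun w : ℂ ↦ ‖w⁻¹‖ :=
    fun x ↦ (locallyIntegrable_inv_complex x).norm
  have hBc := hc.norm.continuous_convolution_right (ContinuousLinearMap.mul ℝ ℝ) hli hF.norm
  obtain ⟨C, hC⟩ := hQ.exists_bound_of_continuousOn hBc.continuousOn
  refine ⟨‖(2 * Real.pi : ℂ)⁻¹‖ * |C|, by positivity, fun G M hM hG z hz ↦ ?_⟩
  have hint := (hc.norm.convolutionExists_right (ContinuousLinearMap.mul ℝ ℝ) hli hF.norm z)
  rw [cauchyTransform, norm_mul, mul_assoc]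
  refine mul_le_mul_of_nonneg_left ?_ (norm_nonneg _)
  refine (norm_integral_le_of_norm_le (hint.mul_const M) (.of_forall fun t ↦ ?_)).trans ?_
  · simp only [ContinuousLinearMap.mul_apply', norm_mul, mul_assoc]
    by_cases h : z - t ∈ tsupport F
    · gcongr
      exact hG _ h
    · simp [image_eq_zero_of_notMem_tsupport h]
  · rw [integral_mul_const]
    exact mul_le_mul_of_nonneg_right
      (((le_abs_self _).trans (hC z hz)).trans (le_abs_self C)) hM

/-- Compactly supported right-hand sides with support in `O` admit solutions of the inhomogeneous
Cauchy–Riemann equation on `W` which are arbitrarily small on `Q`. -/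
def HasSmallDbarSolutions (W Q O : Set ℂ) : Prop :=
  ∀ F : ℂ → ℂ, ContDiff ℝ 1 F → HasCompactSupport F → tsupport F ⊆ O → ∀ ε > 0,
    ∃ u : ℂ → ℂ, (∀ z ∈ W, HasDbarAt u (F z) z) ∧ ∀ z ∈ Q, ‖u z‖ ≤ ε

theorem contDiff_of_tsupport {F : ℂ → ℂ} (h : ∀ z ∈ tsupport F, ContDiffAt ℝ 1 F z) :
    ContDiff ℝ 1 F := by
  rw [contDiff_iff_contDiffAt]
  intro z
  by_cases hz : z ∈ tsupport F
  · exact h z hz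
  · exact contDiffAt_const.congr_of_eventuallyEq (notMem_tsupport_iff_eventuallyEq.1 hz)

theorem hasSmallDbarSolutions_of_weight {W Q O : Set ℂ} (hW : IsOpen W) (hQ : IsCompact Q)
    {p q : ℂ → ℂ} {P M : ℝ} (hp : DifferentiableOn ℂ p W) (hq : ∀ w ∈ O, ContDiffAt ℝ 1 q w)
    (hpq : ∀ w ∈ O, p w * q w = 1) (hP : ∀ z ∈ Q, ‖p z‖ ≤ P) (hP0 : 0 ≤ P)
    (hM : ∀ w ∈ O, ‖q w‖ ≤ M) (hM0 : 0 ≤ M) (hPM : P * M < 1) :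
    HasSmallDbarSolutions W Q O := by
  intro F hF hc hFO ε hε
  obtain ⟨C, hC0, hC⟩ := exists_norm_cauchyTransform_mul_le hF.continuous hc hQ
  obtain ⟨N, hN⟩ : ∃ N : ℕ, C * (P * M) ^ N < ε := by
    have := (tendsto_pow_atTop_nhds_zero_of_lt_one (mul_nonneg hP0 hM0) hPM).const_mul C
    rw [mul_zero] at this
    exact (this.eventually_lt_const hε).exists
  have hG : ContDiff ℝ 1 fun w ↦ F w * q w ^ N := contDiff_of_tsupport fun w hw ↦
    hF.contDiffAt.mul ((hq w (hFO (tsupport_mul_subset_left hw))).pow N)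
  refine ⟨fun z ↦ p z ^ N * cauchyTransform (fun w ↦ F w * q w ^ N) z, fun z hz ↦ ?_,
    fun z hz ↦ ?_⟩
  · have h1 := HasDbarAt.zero_iff.2 ((hp.differentiableAt (hW.mem_nhds hz)).pow N)
    have h2 := h1.mul (hasDbarAt_cauchyTransform hG hc.mul_right z)
    refine ⟨h2.1, h2.2.trans ?_⟩
    by_cases hzF : z ∈ tsupport F
    · simp only [mul_zero, add_zero]
      have := congrArg (· ^ N) (hpq z (hFO hzF))
      simp only [mul_pow, one_pow] at this
      simp only [Pi.pow_apply]
      linear_combination F z * this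
    · simp [image_eq_zero_of_notMem_tsupport hzF]
  · rw [norm_mul, norm_pow]
    have h1 := hC (fun w ↦ q w ^ N) (M ^ N) (by positivity) (fun w hw ↦ by
      rw [norm_pow]; exact pow_le_pow_left₀ (norm_nonneg _) (hM w (hFO hw)) N) z hz
    calc ‖p z‖ ^ N * ‖cauchyTransform (fun w ↦ F w * q w ^ N) z‖
        ≤ P ^ N * (C * M ^ N) := by
          gcongr
          exact hP z hz
      _ = C * (P * M) ^ N := by rw [mul_pow]; ring
      _ ≤ ε := hN.le

theorem HasSmallDbarSolutions.union {W Q O₁ O₂ : Set ℂ} (hO₁ : IsOpen O₁) (hO₂ : IsOpen O₂)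
    (h₁ : HasSmallDbarSolutions W Q O₁) (h₂ : HasSmallDbarSolutions W Q O₂) :
    HasSmallDbarSolutions W Q (O₁ ∪ O₂) := by
  intro F hF hc hFO ε hε
  obtain ⟨η, hη0, hη1, -⟩ := exists_contMDiffMap_zero_one_nhds_of_isClosed (n := 1)
    (modelWithCornersSelf ℝ ℂ) (s := O₁ᶜ) (t := tsupport F \ O₂) hO₁.isClosed_compl
    ((isClosed_tsupport F).sdiff hO₂)
    (disjoint_left.2 fun z hz hz' ↦ hz'.2 ((hFO hz'.1).resolve_left hz))
  have hη : ContDiff ℝ 1 η := η.contMDiff.contDiff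
  have hηC : ContDiff ℝ 1 fun z ↦ (η z : ℂ) := ofRealCLM.contDiff.comp hη
  rw [eventually_nhdsSet_iff_forall] at hη0 hη1
  obtain ⟨u₁, hu₁, hs₁⟩ := h₁ (fun z ↦ F z * η z) (hF.mul hηC) hc.mul_right (by
    intro z hz
    by_contra h
    refine notMem_tsupport_iff_eventuallyEq.2 ?_ hz
    filter_upwards [hη0 z h] with w hw
    simp [hw]) (ε / 2) (by positivity)
  obtain ⟨u₂, hu₂, hs₂⟩ := h₂ (fun z ↦ F z * (1 - η z)) (hF.mul (contDiff_const.sub hηC))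
    hc.mul_right (by
    intro z hz
    by_contra h
    refine notMem_tsupport_iff_eventuallyEq.2 ?_ hz
    filter_upwards [hη1 z ⟨tsupport_mul_subset_left hz, h⟩] with w hw
    simp [hw]) (ε / 2) (by positivity)
  refine ⟨fun z ↦ u₁ z + u₂ z, fun z hz ↦ ?_, fun z hz ↦ ?_⟩
  · convert (hu₁ z hz).add (hu₂ z hz) using 1
    ring
  · linarith [norm_add_le (u₁ z) (u₂ z), hs₁ z hz, hs₂ z hz]

/-- The `n`-th set of the standard exhaustion of `W` by compact sets. -/
def exhaustionSet (W : Set ℂ) (n : ℕ) : Set ℂ :=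
  {z | ‖z‖ ≤ n + 1 ∧ ∀ a ∉ W, 1 ≤ (n + 1) * ‖z - a‖}

theorem isCompact_exhaustionSet (W : Set ℂ) (n : ℕ) : IsCompact (exhaustionSet W n) := by
  refine Metric.isCompact_of_isClosed_isBounded ?_
    (Metric.isBounded_closedBall.subset (fun z hz ↦ mem_closedBall_zero_iff.2 hz.1))
  have : exhaustionSet W n = {z | ‖z‖ ≤ n + 1} ∩ ⋂ a ∈ Wᶜ, {z | 1 ≤ (n + 1) * ‖z - a‖} := by
    ext z
    simp [exhaustionSet]
  rw [this]
  exact (isClosed_le continuous_norm continuous_const).inter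
    (isClosed_biInter fun a _ ↦ isClosed_le continuous_const (by fun_prop))

theorem exhaustionSet_subset (W : Set ℂ) (n : ℕ) : exhaustionSet W n ⊆ W := by
  intro z hz
  by_contra h
  have := hz.2 z h
  simp at this
  linarith

theorem exhaustionSet_subset_interior (W : Set ℂ) {m n : ℕ} (h : m < n) :
    exhaustionSet W m ⊆ interior (exhaustionSet W n) := by
  intro z hz
  have hmn : (m : ℝ) + 1 ≤ n := by exact_mod_cast h
  have hm : (0 : ℝ) < m + 1 := by positivity
  have hn : (0 : ℝ) < n + 1 := by positivity
  rw [mem_interior_iff_mem_nhds, Metric.mem_nhds_iff]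
  have hδ : 0 < min 1 (((m : ℝ) + 1)⁻¹ - ((n : ℝ) + 1)⁻¹) :=
    lt_min one_pos (sub_pos.2 (inv_strictAnti₀ hm (by linarith)))
  refine ⟨_, hδ, fun w hw ↦ ?_⟩
  rw [mem_ball_iff_norm, lt_min_iff] at hw
  refine ⟨?_, fun a ha ↦ ?_⟩
  · linarith [norm_sub_norm_le w z, hz.1]
  · have h1 := hz.2 a ha
    have h2 := norm_sub_le_norm_sub_add_norm_sub z w a
    rw [norm_sub_rev z w] at h2
    rw [← inv_le_iff_one_le_mul₀' hm] at h1
    rw [← inv_le_iff_one_le_mul₀' hn]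
    linarith

theorem exists_mem_exhaustionSet {W : Set ℂ} (hW : IsOpen W) {z : ℂ} (hz : z ∈ W) :
    ∃ n, z ∈ exhaustionSet W n := by
  obtain ⟨r, hr, hrW⟩ := Metric.isOpen_iff.1 hW z hz
  obtain ⟨n, hn⟩ := exists_nat_ge (max ‖z‖ r⁻¹)
  rw [max_le_iff] at hn
  refine ⟨n, by linarith [hn.1], fun a ha ↦ ?_⟩
  have h1 : r ≤ ‖z - a‖ := by
    by_contra h
    rw [not_le, norm_sub_rev, ← mem_ball_iff_norm] at h
    exact ha (hrW h)
  calc (1 : ℝ) = r⁻¹ * r := by field_simp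
    _ ≤ (n + 1) * ‖z - a‖ := by gcongr; linarith [hn.2]

theorem hasSmallDbarSolutions_exhaustionSet {W : Set ℂ} (hW : IsOpen W) (n : ℕ) :
    HasSmallDbarSolutions W (exhaustionSet W n) (W \ exhaustionSet W n) := by
  intro F hF hc hFO
  suffices ∃ O, IsOpen O ∧ tsupport F ⊆ O ∧ HasSmallDbarSolutions W (exhaustionSet W n) O by
    obtain ⟨O, -, hsub, hO⟩ := this
    exact hO F hF hc hsub
  refine hc.isCompact.induction_on (p := fun s ↦ ∃ O, IsOpen O ∧ s ⊆ O ∧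
    HasSmallDbarSolutions W (exhaustionSet W n) O) ?_ ?_ ?_ ?_
  · refine ⟨∅, isOpen_empty, Subset.rfl, ?_⟩
    exact hasSmallDbarSolutions_of_weight hW (isCompact_exhaustionSet W n) (p := 0) (q := 0)
      (P := 0) (M := 0) (differentiableOn_const 0) (by simp) (by simp) (by simp) le_rfl
      (by simp) le_rfl (by simp)
  · rintro s t hst ⟨O, h1, h2, h3⟩
    exact ⟨O, h1, hst.trans h2, h3⟩
  · rintro s t ⟨O, h1, h2, h3⟩ ⟨O', h1', h2', h3'⟩
    exact ⟨O ∪ O', h1.union h1', union_subset_union h2 h2', h3.union h1 h1' h3'⟩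
  · intro w hw
    suffices ∃ O, IsOpen O ∧ w ∈ O ∧ HasSmallDbarSolutions W (exhaustionSet W n) O by
      obtain ⟨O, h1, h2, h3⟩ := this
      exact ⟨O, mem_nhdsWithin_of_mem_nhds (h1.mem_nhds h2), O, h1, Subset.rfl, h3⟩
    have hwn := (hFO hw).2
    have hn : (0 : ℝ) < n + 1 := by positivity
    by_cases hlarge : ‖w‖ ≤ n + 1
    · obtain ⟨a, ha, hwa⟩ : ∃ a ∉ W, (n + 1) * ‖w - a‖ < 1 := by
        by_contra! hcon
        exact hwn ⟨hlarge, hcon⟩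
      rw [← lt_inv_mul_iff₀ hn, mul_one] at hwa
      obtain ⟨ρ, hρ1, hρ2⟩ := exists_between hwa
      refine ⟨{x | x ≠ a ∧ ‖x - a‖ < ρ}, isOpen_ne.inter
        (isOpen_lt (f := fun x ↦ ‖x - a‖) (g := fun _ ↦ ρ) (by fun_prop) (by fun_prop)),
        ⟨ne_of_mem_of_not_mem (hFO hw).1 ha, hρ1⟩, ?_⟩
      refine hasSmallDbarSolutions_of_weight hW (isCompact_exhaustionSet W n)
        (p := fun z ↦ (z - a)⁻¹) (q := fun z ↦ z - a) (P := n + 1) (M := ρ) ?_ ?_ ?_ ?_ hn.le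
        (fun x hx ↦ hx.2.le) ((norm_nonneg _).trans hρ1.le)
        ((lt_inv_mul_iff₀ hn).1 (by rwa [mul_one]))
      · exact (differentiableOn_id.sub_const a).fun_inv fun x hx ↦
          sub_ne_zero.2 (ne_of_mem_of_not_mem hx ha)
      · intro x _
        fun_prop
      · exact fun x hx ↦ inv_mul_cancel₀ (sub_ne_zero.2 hx.1)
      · intro z hz
        have h1 : 0 < ‖z - a‖ :=
          norm_pos_iff.2 (sub_ne_zero.2 (ne_of_mem_of_not_mem (exhaustionSet_subset W n hz) ha))
        rw [norm_inv]
        exact inv_le_of_inv_le₀ hn ((inv_le_iff_one_le_mul₀' hn).2 (hz.2 a ha))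
    · obtain ⟨ρ, hρ1, hρ2⟩ := exists_between (not_le.1 hlarge)
      have hρ : 0 < ρ := hn.trans hρ1
      have hne : ∀ x : ℂ, ρ < ‖x‖ → x ≠ 0 := fun x hx ↦ norm_pos_iff.1 (hρ.trans hx)
      refine ⟨{x | ρ < ‖x‖}, isOpen_lt (by fun_prop) (by fun_prop), hρ2, ?_⟩
      refine hasSmallDbarSolutions_of_weight hW (isCompact_exhaustionSet W n)
        (p := fun z ↦ z) (q := fun z ↦ z⁻¹) (P := n + 1) (M := ρ⁻¹) differentiableOn_id ?_
        (fun x hx ↦ mul_inv_cancel₀ (hne x hx)) (fun z hz ↦ hz.1) hn.le ?_ (by positivity) ?_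
      · exact fun x hx ↦ (contDiffAt_inv ℂ (hne x hx)).restrict_scalars ℝ
      · intro x hx
        rw [norm_inv]
        exact inv_anti₀ hρ (le_of_lt hx)
      · rwa [← div_eq_mul_inv, div_lt_one hρ]

/-- The inhomogeneous Cauchy–Riemann equation is solvable on every open subset of `ℂ`. -/
theorem exists_hasDbarAt {W : Set ℂ} (hW : IsOpen W) {f : ℂ → ℂ}
    (hf : ∀ z ∈ W, ContDiffAt ℝ 1 f z) : ∃ u : ℂ → ℂ, ∀ z ∈ W, HasDbarAt u (f z) z := by
  set Q := exhaustionSet W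
  have hint : ∀ {m n}, m < n → Q m ⊆ interior (Q n) := exhaustionSet_subset_interior W
  have hmono : ∀ {m n}, m ≤ n → Q m ⊆ Q n := fun h ↦ by
    rcases h.eq_or_lt with rfl | h
    exacts [Subset.rfl, (hint h).trans interior_subset]
  have hcut : ∀ n, ∃ ψ : ℂ → ℝ, ContDiff ℝ 1 ψ ∧ tsupport ψ ⊆ Q (n + 1) ∧
      ∀ z ∈ Q n, ψ =ᶠ[𝓝 z] 1 := by
    intro n
    obtain ⟨ψ, h0, h1, -⟩ := exists_contMDiffMap_zero_one_nhds_of_isClosed (n := 1)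
      (modelWithCornersSelf ℝ ℂ) (s := (interior (Q (n + 1)))ᶜ) (t := Q n)
      isOpen_interior.isClosed_compl (isCompact_exhaustionSet W n).isClosed
      (disjoint_left.2 fun z hz hz' ↦ hz (hint n.lt_succ_self hz'))
    rw [eventually_nhdsSet_iff_forall] at h0 h1
    refine ⟨ψ, ψ.contMDiff.contDiff, fun z hz ↦ interior_subset ?_, h1⟩
    by_contra h
    exact notMem_tsupport_iff_eventuallyEq.2 (h0 z h) hz
  choose ψ hψ hsupp hone using hcut
  have hreg : ∀ (n : ℕ) (ρ : ℂ → ℝ), ContDiff ℝ 1 ρ → tsupport ρ ⊆ Q n →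
      ContDiff ℝ 1 (fun z ↦ (ρ z : ℂ) * f z) ∧ HasCompactSupport (fun z ↦ (ρ z : ℂ) * f z) ∧
        tsupport (fun z ↦ (ρ z : ℂ) * f z) ⊆ tsupport ρ := by
    intro n ρ hρ hn
    have hsub : tsupport (fun z ↦ (ρ z : ℂ) * f z) ⊆ tsupport ρ :=
      closure_mono fun z hz h ↦ hz (by simp [h])
    refine ⟨contDiff_of_tsupport fun z hz ↦ ?_, ?_, hsub⟩
    · exact (ofRealCLM.contDiff.comp hρ).contDiffAt.mul
        (hf z (exhaustionSet_subset W n (hn (hsub hz))))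
    · exact (isCompact_exhaustionSet W n).of_isClosed_subset (isClosed_tsupport _) (hsub.trans hn)
  have hdiff : ∀ n, tsupport (fun z ↦ ψ (n + 1) z - ψ n z) ⊆ Q (n + 2) := fun n ↦
    (tsupport_sub (ψ (n + 1)) (ψ n)).trans
      (union_subset (hsupp (n + 1)) ((hsupp n).trans (hmono (by omega))))
  have hpiece : ∀ n, ∃ v : ℂ → ℂ,
      (∀ z ∈ W, HasDbarAt v (((ψ (n + 1) z - ψ n z : ℝ) : ℂ) * f z) z) ∧
        ∀ z ∈ Q n, ‖v z‖ ≤ (1 / 2) ^ n := by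
    intro n
    obtain ⟨h1, h2, h3⟩ := hreg (n + 2) _ ((hψ (n + 1)).sub (hψ n)) (hdiff n)
    refine hasSmallDbarSolutions_exhaustionSet hW n _ h1 h2 (fun z hz ↦
      ⟨exhaustionSet_subset W _ (hdiff n (h3 hz)), fun hzn ↦ ?_⟩) _ (by positivity)
    refine notMem_tsupport_iff_eventuallyEq.2 ?_ (h3 hz)
    filter_upwards [hone n z hzn, hone (n + 1) z (hmono n.le_succ hzn)] with w hw hw'
    simp [hw, hw']
  choose v hv hsmall using hpiece
  obtain ⟨h1, h2, -⟩ := hreg 1 (ψ 0) (hψ 0) (hsupp 0)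
  refine ⟨fun z ↦ cauchyTransform (fun z ↦ (ψ 0 z : ℂ) * f z) z + ∑' n, v n z, fun z hz ↦ ?_⟩
  obtain ⟨m, hm⟩ := exists_mem_exhaustionSet hW hz
  set O := interior (Q (m + 1))
  have hzO : z ∈ O := hint m.lt_succ_self hm
  have hOQ : ∀ n, O ⊆ Q (n + (m + 1)) := fun n ↦ interior_subset.trans (hmono (by omega))
  have hgeo : Summable fun n : ℕ ↦ (1 / 2 : ℝ) ^ (n + (m + 1)) :=
    (summable_nat_add_iff (m + 1)).2 summable_geometric_two
  have htail : DifferentiableOn ℂ (fun w ↦ ∑' n, v (n + (m + 1)) w) O := by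
    refine differentiableOn_tsum_of_summable_norm hgeo (fun n w hw ↦ ?_) isOpen_interior
      fun n w hw ↦ hsmall _ w (hOQ n hw)
    have hwQ := hOQ n hw
    refine (HasDbarAt.zero_iff.1 ?_).differentiableWithinAt
    have := hv (n + (m + 1)) w (exhaustionSet_subset W _ hwQ)
    rwa [(hone _ w hwQ).self_of_nhds, (hone _ w (hmono (Nat.le_succ _) hwQ)).self_of_nhds,
      Pi.one_apply, sub_self, ofReal_zero, zero_mul] at this
  have hsplit : ∀ w ∈ O, ∑' n, v n w =
      ∑ n ∈ Finset.range (m + 1), v n w + ∑' n, v (n + (m + 1)) w := fun w hw ↦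
    (Summable.sum_add_tsum_nat_add (m + 1) ((summable_nat_add_iff (m + 1)).1
      (Summable.of_norm_bounded hgeo fun n ↦ hsmall _ w (hOQ n hw)))).symm
  have hd := ((hasDbarAt_cauchyTransform h1 h2 z).add
    (HasDbarAt.sum (s := Finset.range (m + 1)) fun n _ ↦ hv n z hz)).add
    (HasDbarAt.zero_iff.2 (htail.differentiableAt (isOpen_interior.mem_nhds hzO)))
  have hval : (ψ 0 z : ℂ) * f z +
      ∑ n ∈ Finset.range (m + 1), ((ψ (n + 1) z - ψ n z : ℝ) : ℂ) * f z + 0 = f z := by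
    rw [← Finset.sum_mul, ← ofReal_sum, Finset.sum_range_sub (fun n ↦ ψ n z),
      (hone (m + 1) z (hmono m.le_succ hm)).self_of_nhds]
    simp only [Pi.one_apply]
    push_cast
    ring
  rw [hval] at hd
  refine hd.congr_of_eventuallyEq ?_
  filter_upwards [isOpen_interior.mem_nhds hzO] with w hw
  rw [hsplit w hw, add_assoc]

/-- A smooth function on `A ∪ B` which vanishes near `A \ B` and equals one near `B \ A`. -/
theorem exists_smooth_cutoff {A B : Set ℂ} (hA : IsOpen A) (hB : IsOpen B) :
    ∃ χ : ℂ → ℂ, (∀ z ∈ A ∪ B, ContDiffAt ℝ 2 χ z) ∧ (∀ z ∈ A \ B, χ =ᶠ[𝓝 z] fun _ ↦ 0) ∧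
      ∀ z ∈ B \ A, χ =ᶠ[𝓝 z] fun _ ↦ 1 := by
  obtain ⟨α, hα, hαs, hα0⟩ := hA.exists_contDiff_support_eq (n := 2)
  obtain ⟨β, hβ, hβs, hβ0⟩ := hB.exists_contDiff_support_eq (n := 2)
  have hα0 : ∀ z, 0 ≤ α z := fun z ↦ (hα0 (mem_range_self z)).1
  have hβ0 : ∀ z, 0 ≤ β z := fun z ↦ (hβ0 (mem_range_self z)).1
  have hαA : ∀ z, α z ≠ 0 ↔ z ∈ A := fun z ↦ by rw [← hα, Function.mem_support]
  have hβB : ∀ z, β z ≠ 0 ↔ z ∈ B := fun z ↦ by rw [← hβ, Function.mem_support]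
  have hpos : ∀ z ∈ A ∪ B, α z + β z ≠ 0 := by
    rintro z (hz | hz)
    · exact (add_pos_of_pos_of_nonneg ((hα0 z).lt_of_ne' ((hαA z).2 hz)) (hβ0 z)).ne'
    · exact (add_pos_of_nonneg_of_pos (hα0 z) ((hβ0 z).lt_of_ne' ((hβB z).2 hz))).ne'
  set σ : ℂ → ℝ := fun z ↦ 3 * (β z / (α z + β z)) - 1 with hσ
  have hσd : ∀ z ∈ A ∪ B, ContDiffAt ℝ 2 σ z := fun z hz ↦
    (contDiffAt_const.mul (hβs.contDiffAt.div (hαs.contDiffAt.add hβs.contDiffAt)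
      (hpos z hz))).sub contDiffAt_const
  refine ⟨fun z ↦ (Real.smoothTransition (σ z) : ℂ), fun z hz ↦ ?_, fun z hz ↦ ?_, fun z hz ↦ ?_⟩
  · exact ofRealCLM.contDiff.contDiffAt.comp z
      (Real.smoothTransition.contDiffAt.comp z (hσd z hz))
  · have h0 : σ z < 0 := by
      have : β z = 0 := not_ne_iff.1 (mt (hβB z).1 hz.2)
      simp [hσ, this]
    filter_upwards [(hσd z (Or.inl hz.1)).continuousAt.eventually_lt_const h0] with w hw
    rw [Real.smoothTransition.zero_of_nonpos hw.le, ofReal_zero]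
  · have h1 : 1 < σ z := by
      have : α z = 0 := not_ne_iff.1 (mt (hαA z).1 hz.2)
      simp only [hσ, this, zero_add, div_self ((hβB z).2 hz.1)]
      norm_num
    filter_upwards [(hσd z (Or.inr hz.1)).continuousAt.eventually_const_lt h1] with w hw
    rw [Real.smoothTransition.one_of_one_le hw.le, ofReal_one]

/-- Every holomorphic function on the intersection of two open sets `A`, `B` of the plane is the
difference of a holomorphic function on `A` and a holomorphic function on `B`. -/
theorem exists_differentiableOn_sub_eq {A B : Set ℂ} (hA : IsOpen A) (hB : IsOpen B) {h : ℂ → ℂ}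
    (hh : DifferentiableOn ℂ h (A ∩ B)) :
    ∃ g φ : ℂ → ℂ, DifferentiableOn ℂ g A ∧ DifferentiableOn ℂ φ B ∧ ∀ z, g z = h z + φ z := by
  obtain ⟨χ, hχ, hχ0, hχ1⟩ := exists_smooth_cutoff hA hB
  have hχd : ∀ z ∈ A ∪ B, HasDbarAt χ (fderiv ℝ χ z 1 + I * fderiv ℝ χ z I) z := fun z hz ↦
    ⟨(hχ z hz).differentiableAt two_ne_zero, rfl⟩
  set f : ℂ → ℂ := fun z ↦ h z * (fderiv ℝ χ z 1 + I * fderiv ℝ χ z I) with hf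
  have hconst : ∀ z c, (χ =ᶠ[𝓝 z] fun _ ↦ c) → f =ᶠ[𝓝 z] fun _ ↦ 0 := by
    intro z c hz
    filter_upwards [hz.fderiv (𝕜 := ℝ)] with w hw
    simp [hf, hw]
  have hh' : ∀ z ∈ A ∩ B, DifferentiableAt ℂ h z := fun z hz ↦
    hh.differentiableAt ((hA.inter hB).mem_nhds hz)
  have hfW : ∀ z ∈ A ∪ B, ContDiffAt ℝ 1 f z := by
    intro z hz
    by_cases hzA : z ∈ A
    · by_cases hzB : z ∈ B
      · have h1 : ContDiffAt ℝ 1 h z :=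
          (hh.analyticAt ((hA.inter hB).mem_nhds ⟨hzA, hzB⟩)).contDiffAt.restrict_scalars ℝ
        have h2 : ContDiffAt ℝ 1 (fderiv ℝ χ) z := (hχ z hz).fderiv_right (by norm_num)
        exact h1.mul ((h2.clm_apply contDiffAt_const).add
          (contDiffAt_const.mul (h2.clm_apply contDiffAt_const)))
      · exact contDiffAt_const.congr_of_eventuallyEq (hconst z 0 (hχ0 z ⟨hzA, hzB⟩))
    · exact contDiffAt_const.congr_of_eventuallyEq
        (hconst z 1 (hχ1 z ⟨hz.resolve_left hzA, hzA⟩))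
  obtain ⟨u, hu⟩ := exists_hasDbarAt (hA.union hB) hfW
  have hzero : ∀ z, HasDbarAt (fun _ ↦ 0) 0 z := fun z ↦
    HasDbarAt.zero_iff.2 (differentiableAt_const 0)
  have hone : ∀ z, HasDbarAt (fun _ ↦ 1) 0 z := fun z ↦
    HasDbarAt.zero_iff.2 (differentiableAt_const 1)
  refine ⟨fun z ↦ χ z * h z - u z, fun z ↦ (χ z - 1) * h z - u z, fun z hz ↦ ?_, fun z hz ↦ ?_,
    fun z ↦ by ring⟩
  · refine (HasDbarAt.zero_iff.1 ?_).differentiableWithinAt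
    have hzW : z ∈ A ∪ B := Or.inl hz
    by_cases hzB : z ∈ B
    · convert ((hχd z hzW).mul (HasDbarAt.zero_iff.2 (hh' z ⟨hz, hzB⟩))).sub (hu z hzW) using 1
      simp [hf]
    · have h0 := hχ0 z ⟨hz, hzB⟩
      have h1 : HasDbarAt (fun w ↦ χ w * h w) 0 z := (hzero z).congr_of_eventuallyEq <| by
        filter_upwards [h0] with w hw
        rw [hw, zero_mul]
      simpa [(hconst z 0 h0).self_of_nhds] using h1.sub (hu z hzW)
  · refine (HasDbarAt.zero_iff.1 ?_).differentiableWithinAt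
    have hzW : z ∈ A ∪ B := Or.inr hz
    by_cases hzA : z ∈ A
    · convert (((hχd z hzW).sub (hone z)).mul
        (HasDbarAt.zero_iff.2 (hh' z ⟨hzA, hz⟩))).sub (hu z hzW) using 1
      simp [hf]
    · have h0 := hχ1 z ⟨hz, hzA⟩
      have h1 : HasDbarAt (fun w ↦ (χ w - 1) * h w) 0 z :=
        (hzero z).congr_of_eventuallyEq <| by
          filter_upwards [h0] with w hw
          rw [hw, sub_self, zero_mul]
      simpa [(hconst z 1 h0).self_of_nhds] using h1.sub (hu z hzW)

end HyperfunctionFlabby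

/-- Flabbiness of one-dimensional hyperfunctions: let `U ⊆ ℂ` be open, `I = U ∩ ℝ`,
and let `h` be holomorphic on `U ∖ ℝ`. Then there exist `g` holomorphic on `ℂ ∖ ℝ`,
an open set `V` with `I ⊆ V ⊆ U`, and `φ` holomorphic on `V`, such that
`g = h + φ` on `V ∖ ℝ`.  Thus every hyperfunction on `I` extends to a hyperfunction
on all of `ℝ`: the restriction morphisms of the sheaf of hyperfunctions are
surjective. -/
theorem hyperfunctions_flabby (U : Set ℂ) (hU : IsOpen U) (h : ℂ → ℂ)
    (hh : DifferentiableOn ℂ h (U \ Set.range Complex.ofReal)) :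
    ∃ (g φ : ℂ → ℂ) (V : Set ℂ), IsOpen V ∧
      U ∩ Set.range Complex.ofReal ⊆ V ∧ V ⊆ U ∧
      DifferentiableOn ℂ g (Set.range Complex.ofReal)ᶜ ∧
      DifferentiableOn ℂ φ V ∧
      ∀ z ∈ V \ Set.range Complex.ofReal, g z = h z + φ z := by
  obtain ⟨g, φ, hg, hφ, h_eq⟩ := HyperfunctionFlabby.exists_differentiableOn_sub_eq
    Complex.isometry_ofReal.isClosedEmbedding.isClosed_range.isOpen_compl hU (h := h)
    (hh.mono fun z hz ↦ ⟨hz.2, hz.1⟩)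
  exact ⟨g, φ, U, hU, Set.inter_subset_left, Set.Subset.rfl, hg, hφ, fun z _ ↦ h_eq z⟩
end
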